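/- For every A > 0, the infimum e_≤(A) := inf{ (Per(Ω) + D(Ω))/|Ω| : Ω ⊂ R^3 measurable of finite perimeter with 0 < |Ω| ≤ A } is attained. -/

import Mathlib

open MeasureTheory Filter Metric Set Topology

noncomputable section

/-- De Giorgi perimeter: the set of values `∫_E div F` over admissible vector fields. -/
def perSet (d : ℕ) (E : Set (EuclideanSpace ℝ (Fin d))) : Set ℝ :=
  {p | ∃ F : EuclideanSpace ℝ (Fin d) → EuclideanSpace ℝ (Fin d),
      ContDiff ℝ 1 F ∧ HasCompactSupport F ∧ (∀ x, ‖F x‖ ≤ 1) ∧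
      p = ∫ x in E, ∑ i, fderiv ℝ F x (EuclideanSpace.single i (1:ℝ)) i}

/-- De Giorgi perimeter of a measurable set. -/
def perimeter (d : ℕ) (E : Set (EuclideanSpace ℝ (Fin d))) : ℝ := sSup (perSet d E)

/-- A set has finite perimeter if the defining supremum is finite. -/
def FinitePerimeter (d : ℕ) (E : Set (EuclideanSpace ℝ (Fin d))) : Prop := BddAbove (perSet d E)

/-- Riesz interaction energy. -/
def riesz (d : ℕ) (l : ℝ) (A : Set (EuclideanSpace ℝ (Fin d))) : ℝ :=
  (1/2) * ∫ x in A, ∫ y in A, ‖x - y‖ ^ (-l)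

abbrev E3 := EuclideanSpace ℝ (Fin 3)

/-- Coulomb self-energy in dimension 3. -/
def coulomb (Ω : Set E3) : ℝ := (1/2) * ∫ x in Ω, ∫ y in Ω, ‖x - y‖⁻¹

/-- Liquid drop energy. -/
def ldEnergy (Ω : Set E3) : ℝ := perimeter 3 Ω + coulomb Ω

/-- Minimal liquid drop energy at mass `A`. -/
def ldE (A : ℝ) : ℝ :=
  sInf {e | ∃ Ω : Set E3, MeasurableSet Ω ∧ FinitePerimeter 3 Ω ∧
      volume Ω = ENNReal.ofReal A ∧ e = ldEnergy Ω}


/-- Energy per particle of a set. -/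
def ldRatio (Ω : Set E3) : ℝ := ldEnergy Ω / (volume Ω).toReal

/-- The relaxed minimal energy per particle with mass at most `A`. -/
def eLe (A : ℝ) : ℝ :=
  sInf {r | ∃ Ω : Set E3, MeasurableSet Ω ∧ FinitePerimeter 3 Ω ∧
      0 < volume Ω ∧ volume Ω ≤ ENNReal.ofReal A ∧ r = ldRatio Ω}

/-- The divergence of a vector field on `ℝ³`. -/
def dvg (F : E3 → E3) (x : E3) : ℝ :=
  ∑ i, fderiv ℝ F x (EuclideanSpace.single i (1:ℝ)) i

/-- The test fields in the definition of the perimeter. -/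
structure Admissible (F : E3 → E3) : Prop where
  contDiff : ContDiff ℝ 1 F
  compact : HasCompactSupport F
  norm_le : ∀ x, ‖F x‖ ≤ 1

lemma continuous_dvg {F : E3 → E3} (hF : ContDiff ℝ 1 F) : Continuous (dvg F) := by
  have h := hF.continuous_fderiv one_ne_zero
  unfold dvg
  refine continuous_finsetSum _ fun i _ => ?_
  exact (EuclideanSpace.proj (𝕜 := ℝ) i).continuous.comp (h.clm_apply continuous_const)

lemma hasCompactSupport_dvg {F : E3 → E3} (hF : HasCompactSupport F) :
    HasCompactSupport (dvg F) := by
  refine (hF.fderiv (𝕜 := ℝ)).mono fun x hx => ?_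
  contrapose! hx
  simp only [Function.mem_support, not_not] at hx ⊢
  simp [dvg, hx]

lemma integrable_dvg {F : E3 → E3} (hF : ContDiff ℝ 1 F) (hc : HasCompactSupport F) :
    Integrable (dvg F) :=
  (continuous_dvg hF).integrable_of_hasCompactSupport (hasCompactSupport_dvg hc)

lemma integral_fderiv_apply_eq_zero {g : E3 → ℝ} (hg : ContDiff ℝ 1 g)
    (hc : HasCompactSupport g) (v : E3) : ∫ x, fderiv ℝ g x v = 0 := by
  have hi : Integrable (fun x => fderiv ℝ g x v) :=
    ((hg.continuous_fderiv one_ne_zero).clm_apply continuous_const).integrable_of_hasCompactSupport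
      (hc.fderiv_apply (𝕜 := ℝ) v)
  have := integral_mul_fderiv_eq_neg_fderiv_mul_of_integrable (𝕜 := ℝ) (μ := (volume : Measure E3))
    (f := fun _ => (1:ℝ)) (g := g) (v := v) (by simp) (by simpa using hi)
    (by simpa using hg.continuous.integrable_of_hasCompactSupport hc) (by simp)
    (fun x _ => hg.differentiable one_ne_zero x)
  simpa using this

lemma fderiv_coord {F : E3 → E3} (hF : ContDiff ℝ 1 F) (x v : E3) (i : Fin 3) :
    fderiv ℝ F x v i = fderiv ℝ (fun y => F y i) x v := by
  have h : HasFDerivAt (fun y => F y i)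
      ((EuclideanSpace.proj (𝕜 := ℝ) i : E3 →L[ℝ] ℝ).comp (fderiv ℝ F x)) x :=
    (EuclideanSpace.proj (𝕜 := ℝ) i : E3 →L[ℝ] ℝ).hasFDerivAt.comp x
      (hF.differentiable one_ne_zero x).hasFDerivAt
  rw [h.fderiv]; rfl

lemma integral_dvg_eq_zero {F : E3 → E3} (hF : ContDiff ℝ 1 F) (hc : HasCompactSupport F) :
    ∫ x, dvg F x = 0 := by
  have h1 : ∀ i : Fin 3, ContDiff ℝ 1 (fun y => F y i) := fun i =>
    (EuclideanSpace.proj (𝕜 := ℝ) i : E3 →L[ℝ] ℝ).contDiff.comp hF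
  have h2 : ∀ i : Fin 3, HasCompactSupport (fun y => F y i) := fun i =>
    hc.comp_left (g := fun z : E3 => z i) rfl
  unfold dvg
  simp_rw [fderiv_coord hF]
  rw [integral_finsetSum]
  · exact Finset.sum_eq_zero fun i _ => integral_fderiv_apply_eq_zero (h1 i) (h2 i) _
  · intro i _
    exact (((h1 i).continuous_fderiv one_ne_zero).clm_apply
      continuous_const).integrable_of_hasCompactSupport ((h2 i).fderiv_apply (𝕜 := ℝ) _)

lemma setIntegral_dvg_le {Ω : Set E3} (hΩ : FinitePerimeter 3 Ω) {F : E3 → E3}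
    (hF : Admissible F) : ∫ x in Ω, dvg F x ≤ perimeter 3 Ω :=
  le_csSup hΩ ⟨F, hF.contDiff, hF.compact, hF.norm_le, rfl⟩

lemma zero_admissible : Admissible (fun _ => 0) :=
  ⟨contDiff_const, HasCompactSupport.zero, by simp⟩

lemma dvg_zero (x : E3) : dvg (fun _ => 0) x = 0 := by simp [dvg]

lemma perimeter_nonneg {Ω : Set E3} (hΩ : FinitePerimeter 3 Ω) : 0 ≤ perimeter 3 Ω := by
  simpa [dvg_zero] using setIntegral_dvg_le hΩ zero_admissible

lemma finitePerimeter_of_forall_le {Ω : Set E3} {c : ℝ}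
    (h : ∀ F, Admissible F → ∫ x in Ω, dvg F x ≤ c) : FinitePerimeter 3 Ω := by
  refine ⟨c, ?_⟩
  rintro _ ⟨F, h1, h2, h3, rfl⟩
  exact h F ⟨h1, h2, h3⟩

lemma perimeter_le_of_forall_le {Ω : Set E3} {c : ℝ}
    (h : ∀ F, Admissible F → ∫ x in Ω, dvg F x ≤ c) : perimeter 3 Ω ≤ c := by
  refine csSup_le ⟨_, _, zero_admissible.1, zero_admissible.2, zero_admissible.3, rfl⟩ ?_
  rintro _ ⟨F, h1, h2, h3, rfl⟩
  exact h F ⟨h1, h2, h3⟩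

/-- The product rule for the divergence. -/
lemma dvg_smul {g : E3 → ℝ} {F : E3 → E3} {x : E3} (hg : DifferentiableAt ℝ g x)
    (hF : DifferentiableAt ℝ F x) :
    dvg (fun y => g y • F y) x = g x * dvg F x + fderiv ℝ g x (F x) := by
  have h : fderiv ℝ g x (F x) = ∑ i, F x i * fderiv ℝ g x (EuclideanSpace.single i (1:ℝ)) := by
    conv_lhs => rw [← (EuclideanSpace.basisFun (Fin 3) ℝ).sum_repr (F x)]
    simp [map_sum]
  rw [h]
  unfold dvg
  rw [fderiv_fun_smul hg hF, Finset.mul_sum, ← Finset.sum_add_distrib]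
  refine Finset.sum_congr rfl fun i _ => ?_
  simp [mul_comm]

lemma dvg_add {F G : E3 → E3} {x : E3} (hF : DifferentiableAt ℝ F x)
    (hG : DifferentiableAt ℝ G x) : dvg (fun y => F y + G y) x = dvg F x + dvg G x := by
  unfold dvg
  rw [fderiv_fun_add hF hG]
  simp [Finset.sum_add_distrib]

lemma dvg_sub {F G : E3 → E3} {x : E3} (hF : DifferentiableAt ℝ F x)
    (hG : DifferentiableAt ℝ G x) : dvg (fun y => F y - G y) x = dvg F x - dvg G x := by
  unfold dvg
  rw [fderiv_fun_sub hF hG]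
  simp [Finset.sum_sub_distrib]

/-- Increments of a test function in a direction `v` are controlled by the perimeter. -/
lemma setIntegral_translate_sub_le {Ω : Set E3} (hP : FinitePerimeter 3 Ω) (hv : volume Ω ≠ ⊤)
    {g : E3 → ℝ} (hg : ContDiff ℝ 1 g) (hc : HasCompactSupport g) (h1 : ∀ x, |g x| ≤ 1)
    {v : E3} (hv1 : ‖v‖ ≤ 1) {s : ℝ} (hs : 0 ≤ s) :
    (∫ x in Ω, g (x + s • v)) - ∫ x in Ω, g x ≤ perimeter 3 Ω * s := by
  have : IsFiniteMeasure (volume.restrict Ω) := ⟨by simpa using hv.lt_top⟩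
  have hgd := hg.differentiable one_ne_zero
  have hg' : Continuous (fderiv ℝ g) := hg.continuous_fderiv one_ne_zero
  obtain ⟨K, hK⟩ := (hc.fderiv (𝕜 := ℝ)).exists_bound_of_continuous hg'
  have hlip : ∀ x t, HasDerivAt (fun t : ℝ => g (x + t • v)) (fderiv ℝ g (x + t • v) v) t := by
    intro x t
    have h2 : HasDerivAt (fun t : ℝ => x + t • v) v t := by
      simpa using ((hasDerivAt_id t).smul_const v).const_add x
    exact (hgd _).hasFDerivAt.comp_hasDerivAt t h2
  have hgint : ∀ t : ℝ, Integrable (fun x => g (x + t • v)) (volume.restrict Ω) := fun t =>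
    Integrable.of_bound (C := 1) (by fun_prop) (by simpa using .of_forall fun x => h1 _)
  have hder : ∀ t : ℝ, HasDerivAt (fun t : ℝ => ∫ x in Ω, g (x + t • v))
      (∫ x in Ω, fderiv ℝ g (x + t • v) v) t := by
    intro t
    refine (hasDerivAt_integral_of_dominated_loc_of_deriv_le (F := fun t x => g (x + t • v))
      (F' := fun t x => fderiv ℝ g (x + t • v) v)
      (bound := fun _ => K) (s := univ) univ_mem ?_ (hgint t) ?_ ?_ (integrable_const _) ?_).2
    · exact .of_forall fun t => (hgint t).1
    · exact Continuous.aestronglyMeasurable (by fun_prop)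
    · refine .of_forall fun x t _ => ((fderiv ℝ g _).le_opNorm v).trans ?_
      have := hK (x + t • v)
      nlinarith [norm_nonneg v, norm_nonneg (fderiv ℝ g (x + t • v))]
    · exact .of_forall fun x t _ => hlip x t
  have hle : ∀ t : ℝ, ∫ x in Ω, fderiv ℝ g (x + t • v) v ≤ perimeter 3 Ω := by
    intro t
    have hd : ∀ x, fderiv ℝ (fun y => g (y + t • v)) x = fderiv ℝ g (x + t • v) := fun x =>
      fderiv_comp_add_right _
    have hA : Admissible (fun x => g (x + t • v) • v) := by
      refine ⟨(hg.comp (contDiff_id.add contDiff_const)).smul contDiff_const, ?_, fun x => ?_⟩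
      · exact (hc.comp_homeomorph (Homeomorph.addRight (t • v))).smul_right
      · rw [norm_smul, Real.norm_eq_abs]
        have := h1 (x + t • v)
        nlinarith [norm_nonneg v, abs_nonneg (g (x + t • v))]
    refine le_of_eq_of_le (integral_congr_ae (.of_forall fun x => ?_)) (setIntegral_dvg_le hP hA)
    have h0 : dvg (fun _ => v) x = 0 := by simp [dvg]
    simp only
    rw [dvg_smul (g := fun y => g (y + t • v)) (F := fun _ => v) (by fun_prop) (by fun_prop),
      hd, h0]
    simp
  have := (convex_Icc 0 s).image_sub_le_mul_sub_of_deriv_le (C := perimeter 3 Ω)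
    (f := fun t : ℝ => ∫ x in Ω, g (x + t • v))
    (fun t _ => (hder t).continuousAt.continuousWithinAt)
    (fun t _ => (hder t).differentiableAt.differentiableWithinAt)
    (fun t _ => by rw [(hder t).deriv]; exact hle t) 0 (by simp [hs]) s (by simp [hs]) hs
  simpa using this

/-- A set of finite measure agrees with a smooth compactly supported `[0, 1]`-valued function
outside a set of small measure. -/
lemma exists_contDiff_eq_indicator {Ω : Set E3} (hm : MeasurableSet Ω) (hv : volume Ω ≠ ⊤)
    {ε : ENNReal} (hε : ε ≠ 0) :
    ∃ (g : E3 → ℝ) (D : Set E3), ContDiff ℝ 1 g ∧ HasCompactSupport g ∧ (∀ x, g x ∈ Icc (0:ℝ) 1) ∧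
      MeasurableSet D ∧ volume D ≤ ε ∧ ∀ x ∉ D, g x = Ω.indicator 1 x := by
  have hε2 : ε / 2 ≠ 0 := by simpa using hε
  obtain ⟨K, hKΩ, hK, hKε⟩ := hm.exists_isCompact_sdiff_lt hv hε2
  obtain ⟨U, hΩU, hU, -, hUε⟩ := hm.exists_isOpen_sdiff_lt hv hε2
  obtain ⟨L, hL, hKL, hLU⟩ := exists_compact_between hK hU (hKΩ.trans hΩU)
  obtain ⟨f, hf1, hf0, hf⟩ := exists_contMDiffMap_one_nhds_of_subset_interior
    (n := 1) (modelWithCornersSelf ℝ E3) hK.isClosed hKL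
  refine ⟨f, U \ K, f.contMDiff.contDiff, HasCompactSupport.intro hL hf0, hf,
    hU.measurableSet.diff hK.measurableSet, ?_, fun x hx => ?_⟩
  · calc volume (U \ K) ≤ volume ((U \ Ω) ∪ (Ω \ K)) := by
          refine measure_mono fun x hx => ?_
          by_cases h : x ∈ Ω
          · exact Or.inr ⟨h, hx.2⟩
          · exact Or.inl ⟨hx.1, h⟩
      _ ≤ ε / 2 + ε / 2 := (measure_union_le _ _).trans (add_le_add hUε.le hKε.le)
      _ = ε := ENNReal.add_halves ε
  · by_cases hK' : x ∈ K
    · rw [indicator_of_mem (hKΩ hK')]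
      exact hf1.self_of_nhdsSet x hK'
    · have hU' : x ∉ U := fun h => hx ⟨h, hK'⟩
      rw [indicator_of_notMem (fun h => hU' (hΩU h))]
      exact hf0 x fun h => hU' (hLU h)

/-- The part of a set which leaves it under translation by `h` is controlled by the perimeter. -/
lemma volume_inter_translate_compl_le {Ω : Set E3} (hm : MeasurableSet Ω)
    (hP : FinitePerimeter 3 Ω) (hv : volume Ω ≠ ⊤) (h : E3) :
    volume (Ω ∩ (· + h) ⁻¹' Ωᶜ) ≤ ENNReal.ofReal (perimeter 3 Ω * ‖h‖) := by
  have : IsFiniteMeasure (volume.restrict Ω) := ⟨by simpa using hv.lt_top⟩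
  have hmh : MeasurableSet ((· + h) ⁻¹' Ω) := hm.preimage (measurable_add_const h)
  have hsplit : volume.real (Ω ∩ (· + h) ⁻¹' Ω) + volume.real (Ω ∩ (· + h) ⁻¹' Ωᶜ)
      = volume.real Ω := by
    rw [preimage_compl, ← sdiff_eq]
    exact measureReal_inter_add_sdiff hmh hv
  rw [ENNReal.le_ofReal_iff_toReal_le (measure_ne_top_of_subset inter_subset_left hv)
    (mul_nonneg (perimeter_nonneg hP) (norm_nonneg h))]
  refine le_of_forall_pos_le_add fun ε hε => ?_
  obtain ⟨g, D, hg, hc, h01, hD, hDε, hgD⟩ := exists_contDiff_eq_indicator hm hv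
    (ε := ENNReal.ofReal (ε / 2)) (by simpa using hε)
  have hDtop : volume D ≠ ⊤ := (hDε.trans_lt ENNReal.ofReal_lt_top).ne
  have hDr : volume.real D ≤ ε / 2 := ENNReal.toReal_le_of_le_ofReal (by positivity) hDε
  have hgc := hg.continuous
  obtain ⟨v, hv1, hvh⟩ : ∃ v : E3, ‖v‖ ≤ 1 ∧ ‖h‖ • v = h := by
    rcases eq_or_ne h 0 with rfl | h0
    · exact ⟨0, by simp⟩
    · have : ‖h‖ ≠ 0 := by simpa using h0
      exact ⟨‖h‖⁻¹ • h, by simp [norm_smul, this], by simp [smul_smul, this]⟩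
  have key := setIntegral_translate_sub_le hP hv (g := fun x => - g x) hg.neg
    (hc.comp_left (g := fun y => -y) (by simp))
    (fun x => by rw [abs_neg, abs_of_nonneg (h01 x).1]; exact (h01 x).2) hv1 (norm_nonneg h)
  simp only [hvh, integral_neg] at key
  have hi1 : Integrable g (volume.restrict Ω) :=
    Integrable.of_bound (C := 1) (by fun_prop) (.of_forall fun x => by
      rw [Real.norm_eq_abs, abs_of_nonneg (h01 x).1]; exact (h01 x).2)
  have hi2 : Integrable (fun x => g (x + h)) (volume.restrict Ω) :=
    Integrable.of_bound (C := 1) (by fun_prop) (.of_forall fun x => by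
      rw [Real.norm_eq_abs, abs_of_nonneg (h01 _).1]; exact (h01 _).2)
  have hmD : MeasurableSet ((· + h) ⁻¹' D) := hD.preimage (measurable_add_const h)
  have hind : ∀ {S : Set E3}, MeasurableSet S →
      Integrable (S.indicator (1 : E3 → ℝ)) (volume.restrict Ω) := fun hS =>
    (integrable_const (1:ℝ)).indicator hS
  have e1 : volume.real Ω ≤ (∫ x in Ω, g x) + volume.real D := by
    have : volume.real Ω = ∫ x in Ω, (1:ℝ) := by simp
    rw [this]
    have h2 : ∫ x in Ω, D.indicator (1 : E3 → ℝ) x ≤ volume.real D := by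
      rw [integral_indicator_one hD, measureReal_restrict_apply hD]
      exact measureReal_mono inter_subset_left hDtop
    refine le_trans ?_ (add_le_add_right h2 _)
    rw [← integral_add hi1 (hind hD)]
    refine setIntegral_mono_on (integrable_const _) (hi1.add (hind hD)) hm fun x hx => ?_
    by_cases hxD : x ∈ D
    · simp [hxD, (h01 x).1]
    · simp [hxD, hgD x hxD, hx]
  have e2 : ∫ x in Ω, g (x + h) ≤ volume.real (Ω ∩ (· + h) ⁻¹' Ω) + volume.real D := by
    have h2 : ∫ x in Ω, ((· + h) ⁻¹' D).indicator (1 : E3 → ℝ) x ≤ volume.real D := by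
      rw [integral_indicator_one hmD, measureReal_restrict_apply hmD]
      have h3 : volume ((· + h) ⁻¹' D) = volume D := measure_preimage_add_right _ _ _
      have h4 : volume.real ((· + h) ⁻¹' D) = volume.real D := by simp only [Measure.real, h3]
      rw [← h4]
      exact measureReal_mono inter_subset_left (by rw [h3]; exact hDtop)
    have h5 : volume.real (Ω ∩ (· + h) ⁻¹' Ω) =
        ∫ x in Ω, ((· + h) ⁻¹' Ω).indicator (1 : E3 → ℝ) x := by
      rw [integral_indicator_one hmh, measureReal_restrict_apply hmh, inter_comm]
    rw [h5]
    refine le_trans ?_ (add_le_add_right h2 _)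
    rw [← integral_add (hind hmh) (hind hmD)]
    refine integral_mono hi2 ((hind hmh).add (hind hmD)) fun x => ?_
    by_cases hxD : x + h ∈ D
    · by_cases hxΩ : x + h ∈ Ω
      · simp [indicator, hxD, hxΩ]; linarith [(h01 (x + h)).2]
      · simp [indicator, hxD, hxΩ, (h01 (x + h)).2]
    · simp [indicator, hxD, hgD _ hxD]
      rfl
  change volume.real _ ≤ _
  linarith

lemma volume_compl_inter_translate_le {Ω : Set E3} (hm : MeasurableSet Ω)
    (hP : FinitePerimeter 3 Ω) (hv : volume Ω ≠ ⊤) (h : E3) :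
    volume (Ωᶜ ∩ (· + h) ⁻¹' Ω) ≤ ENNReal.ofReal (perimeter 3 Ω * ‖h‖) := by
  have h1 := volume_inter_translate_compl_le hm hP hv (-h)
  rw [norm_neg] at h1
  refine le_of_eq_of_le ?_ h1
  rw [← measure_preimage_add_right volume (-h) (Ωᶜ ∩ (· + h) ⁻¹' Ω)]
  congr 1
  ext x
  simp [and_comm]

lemma lintegral_volume_ball_inter_le {P Q : Set E3} (hQ : MeasurableSet Q)
    {c r : ℝ} (hc : 0 ≤ c)
    (h : ∀ h : E3, volume (P ∩ (· + h) ⁻¹' Q) ≤ ENNReal.ofReal (c * ‖h‖)) :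
    ∫⁻ x in P, volume (ball x r ∩ Q) ≤ volume (ball (0 : E3) r) * ENNReal.ofReal (c * r) := by
  have e : ∀ x : E3, volume (ball x r ∩ Q)
      = ∫⁻ y in ball (0 : E3) r, Q.indicator (1 : E3 → ENNReal) (x + y) := by
    intro x
    have : ∀ y, Q.indicator (1 : E3 → ENNReal) (x + y) = ((x + ·) ⁻¹' Q).indicator 1 y :=
      fun y => rfl
    simp_rw [this]
    have hmx : MeasurableSet ((x + ·) ⁻¹' Q) := hQ.preimage (measurable_const_add x)
    rw [lintegral_indicator_one hmx, Measure.restrict_apply hmx,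
      ← measure_preimage_add volume x (ball x r ∩ Q)]
    congr 1
    ext y
    simp [and_comm]
  simp_rw [e]
  rw [lintegral_lintegral_swap]
  · have : ∀ y ∈ ball (0 : E3) r,
        ∫⁻ x in P, Q.indicator (1 : E3 → ENNReal) (x + y) ≤ ENNReal.ofReal (c * r) := by
      intro y hy
      have h1 : ∀ x, Q.indicator (1 : E3 → ENNReal) (x + y) = ((· + y) ⁻¹' Q).indicator 1 x :=
        fun x => rfl
      have hmy : MeasurableSet ((· + y) ⁻¹' Q) := hQ.preimage (measurable_add_const y)
      simp_rw [h1]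
      rw [lintegral_indicator_one hmy, Measure.restrict_apply hmy, inter_comm]
      refine (h y).trans (ENNReal.ofReal_le_ofReal ?_)
      exact mul_le_mul_of_nonneg_left (by simpa using (mem_ball_zero_iff.1 hy).le) hc
    refine (setLIntegral_mono' measurableSet_ball this).trans ?_
    simp [mul_comm]
  · have : Measurable (fun p : E3 × E3 => Q.indicator (1 : E3 → ENNReal) (p.1 + p.2)) :=
      (measurable_one.indicator hQ).comp (measurable_fst.add measurable_snd)
    exact this.aemeasurable

/-- A set whose perimeter is small compared to its volume fills half of some ball. -/
lemma exists_half_volume_ball_le {Ω : Set E3} (hm : MeasurableSet Ω)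
    (hP : FinitePerimeter 3 Ω) (hv : volume Ω ≠ ⊤) {r : ℝ} (hr : 0 < r)
    (hs : 2 * (perimeter 3 Ω * r) < volume.real Ω) :
    ∃ x : E3, volume (ball (0 : E3) r) / 2 ≤ volume (ball x r ∩ Ω) := by
  by_contra! hcon
  have h1 := lintegral_volume_ball_inter_le hm.compl (r := r) (perimeter_nonneg hP)
    (volume_inter_translate_compl_le hm hP hv)
  have hb : ∀ x : E3, volume (ball x r) = volume (ball (0 : E3) r) := fun x =>
    Measure.addHaar_ball_center _ _ _
  have hbt : volume (ball (0 : E3) r) ≠ ⊤ := measure_ball_lt_top.ne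
  have hb0 : volume (ball (0 : E3) r) ≠ 0 := (measure_ball_pos _ _ hr).ne'
  have h2 : ∀ x : E3, volume (ball (0 : E3) r) / 2 ≤ volume (ball x r ∩ Ωᶜ) := by
    intro x
    by_contra! h3
    have h4 := ENNReal.add_lt_add (hcon x) h3
    rw [← sdiff_eq, measure_inter_add_sdiff _ hm, hb, ENNReal.add_halves] at h4
    exact lt_irrefl _ h4
  have h5 : volume (ball (0 : E3) r) / 2 * volume Ω
      ≤ volume (ball (0 : E3) r) * ENNReal.ofReal (perimeter 3 Ω * r) := by
    refine le_trans ?_ h1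
    rw [← setLIntegral_const]
    exact lintegral_mono fun x => h2 x
  rw [ENNReal.div_eq_inv_mul, mul_comm (2⁻¹ : ENNReal), mul_assoc,
    ENNReal.mul_le_mul_iff_right hb0 hbt] at h5
  have h6 := ENNReal.toReal_mono ENNReal.ofReal_ne_top h5
  rw [ENNReal.toReal_mul, ENNReal.toReal_ofReal
    (mul_nonneg (perimeter_nonneg hP) hr.le)] at h6
  simp only [ENNReal.toReal_inv, ENNReal.toReal_ofNat] at h6
  change _ * volume.real Ω ≤ _ at h6
  linarith

lemma exists_subseq_tendsto_volume_inter {Ω : ℕ → Set E3} (hm : ∀ n, MeasurableSet (Ω n)) {A : ℝ}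
    (hA : ∀ n, volume (Ω n) ≤ ENNReal.ofReal A) :
    ∃ φ : ℕ → ℕ, StrictMono φ ∧ ∀ x r, ∃ l : ℝ,
      Tendsto (fun n => volume.real (ball x r ∩ Ω (φ n))) atTop (𝓝 l) := by
  have hv : ∀ n, volume (Ω n) ≠ ⊤ := fun n => ((hA n).trans_lt ENNReal.ofReal_lt_top).ne
  have : Fact ((2 : ENNReal) ≠ ⊤) := ⟨by simp⟩
  let u : ℕ → Lp ℝ 2 (volume : Measure E3) := fun n => indicatorConstLp 2 (hm n) (hv n) 1
  let Φ : ℕ → WeakDual ℝ (Lp ℝ 2 (volume : Measure E3)) := fun n =>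
    StrongDual.toWeakDual (InnerProductSpace.toDual ℝ _ (u n))
  obtain ⟨Ψ, -, φ, hφ, hlim⟩ := WeakDual.isSeqCompact_closedBall (𝕜 := ℝ)
    (E := Lp ℝ 2 (volume : Measure E3)) 0 ((max A 0) ^ (1 / 2 : ℝ)) (x := Φ) (fun n => by
      have h1 : ‖u n‖ ≤ (max A 0) ^ (1 / 2 : ℝ) := by
        rw [norm_indicatorConstLp (by simp) (by simp)]
        simp only [norm_one, one_mul, ENNReal.toReal_ofNat]
        refine Real.rpow_le_rpow measureReal_nonneg ?_ (by norm_num)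
        rw [← ENNReal.toReal_ofReal']
        exact ENNReal.toReal_mono ENNReal.ofReal_ne_top (hA n)
      simpa [Φ] using h1)
  refine ⟨φ, hφ, fun x r => ⟨Ψ (indicatorConstLp 2 measurableSet_ball
    (measure_ball_lt_top (x := x) (r := r)).ne 1), ?_⟩⟩
  have h2 := ((WeakDual.eval_continuous (𝕜 := ℝ) (indicatorConstLp 2 measurableSet_ball
    (measure_ball_lt_top (μ := (volume : Measure E3)) (x := x) (r := r)).ne (1:ℝ))).tendsto
      Ψ).comp hlim
  refine h2.congr fun n => ?_
  have h3 := L2.real_inner_indicatorConstLp_one_indicatorConstLp_one (μ := (volume : Measure E3))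
    (hm (φ n)) (measurableSet_ball (x := x) (ε := r)) (hv _) measure_ball_lt_top.ne
  rw [inter_comm, ← h3]
  rfl

/-- The fraction of the ball of radius `r` around `x` occupied by `S`. -/
def ballAverage (r : ℝ) (S : Set E3) (x : E3) : ℝ :=
  volume.real (ball x r ∩ S) / volume.real (ball (0 : E3) r)

lemma ballAverage_nonneg (r : ℝ) (S : Set E3) (x : E3) : 0 ≤ ballAverage r S x :=
  div_nonneg measureReal_nonneg measureReal_nonneg

lemma volume_real_ball (r : ℝ) (x : E3) :
    volume.real (ball x r) = volume.real (ball (0 : E3) r) := by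
  simp only [Measure.real, Measure.addHaar_ball_center]

lemma volume_real_ball_pos {r : ℝ} (hr : 0 < r) : 0 < volume.real (ball (0 : E3) r) :=
  ENNReal.toReal_pos (measure_ball_pos _ _ hr).ne' measure_ball_lt_top.ne

lemma ballAverage_le_one (r : ℝ) (S : Set E3) (x : E3) : ballAverage r S x ≤ 1 := by
  refine div_le_one_of_le₀ ?_ measureReal_nonneg
  rw [← volume_real_ball r x]
  exact measureReal_mono inter_subset_left measure_ball_lt_top.ne

lemma measurable_ballAverage (r : ℝ) {S : Set E3} (hS : MeasurableSet S) :
    Measurable (ballAverage r S) := by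
  have h1 : MeasurableSet {p : E3 × E3 | dist p.2 p.1 < r} :=
    measurableSet_lt (measurable_snd.dist measurable_fst) measurable_const
  have h : MeasurableSet {p : E3 × E3 | dist p.2 p.1 < r ∧ p.2 ∈ S} :=
    h1.inter (measurable_snd hS)
  exact ((measurable_measure_prodMk_left (ν := (volume : Measure E3)) h).ennreal_toReal).div_const _

lemma enorm_ballAverage {r : ℝ} (hr : 0 < r) (S : Set E3) (x : E3) :
    ‖ballAverage r S x‖ₑ = volume (ball x r ∩ S) / volume (ball (0 : E3) r) := by
  rw [Real.enorm_eq_ofReal (ballAverage_nonneg r S x), ballAverage, ENNReal.ofReal_div_of_pos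
    (volume_real_ball_pos hr), ofReal_measureReal measure_ball_lt_top.ne, ofReal_measureReal
    (measure_ne_top_of_subset inter_subset_left measure_ball_lt_top.ne)]

lemma one_sub_ballAverage {r : ℝ} (hr : 0 < r) {S : Set E3} (hS : MeasurableSet S) (x : E3) :
    1 - ballAverage r S x = ballAverage r Sᶜ x := by
  have h := measureReal_inter_add_sdiff (μ := volume) (s := ball x r) hS
    (measure_ball_lt_top.ne)
  rw [volume_real_ball, sdiff_eq] at h
  have h0 : (volume.real (ball (0 : E3) r)) ≠ 0 := (volume_real_ball_pos hr).ne'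
  unfold ballAverage
  field_simp
  linarith

/-- Averaging over small balls moves an indicator function little in `L¹`. -/
lemma lintegral_indicator_sub_ballAverage_le {Ω : Set E3} (hm : MeasurableSet Ω)
    (hP : FinitePerimeter 3 Ω) (hv : volume Ω ≠ ⊤) {r : ℝ} (hr : 0 < r) :
    ∫⁻ x, ‖Ω.indicator 1 x - ballAverage r Ω x‖ₑ ≤ 2 * ENNReal.ofReal (perimeter 3 Ω * r) := by
  have hbt : volume (ball (0 : E3) r) ≠ ⊤ := measure_ball_lt_top.ne
  have hb0 : volume (ball (0 : E3) r) ≠ 0 := (measure_ball_pos _ _ hr).ne'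
  have h : ∀ {P Q : Set E3}, MeasurableSet P → (MeasurableSet Q) →
      (∀ x ∈ P, ‖Ω.indicator 1 x - ballAverage r Ω x‖ₑ = ‖ballAverage r Q x‖ₑ) →
      (∀ h : E3, volume (P ∩ (· + h) ⁻¹' Q) ≤ ENNReal.ofReal (perimeter 3 Ω * ‖h‖)) →
      ∫⁻ x in P, ‖Ω.indicator 1 x - ballAverage r Ω x‖ₑ
        ≤ ENNReal.ofReal (perimeter 3 Ω * r) := by
    intro P Q hPm hQ he ht
    rw [setLIntegral_congr_fun hPm he]
    simp_rw [enorm_ballAverage hr, ENNReal.div_eq_inv_mul]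
    rw [lintegral_const_mul' _ _ (by simpa using hb0)]
    refine (mul_le_mul_right (lintegral_volume_ball_inter_le hQ (perimeter_nonneg hP) ht) _).trans ?_
    rw [← mul_assoc, ENNReal.inv_mul_cancel hb0 hbt, one_mul]
  rw [← lintegral_add_compl _ hm, two_mul]
  refine add_le_add (h hm hm.compl (fun x hx => ?_) (volume_inter_translate_compl_le hm hP hv))
    (h hm.compl hm (fun x hx => ?_) (volume_compl_inter_translate_le hm hP hv))
  · rw [indicator_of_mem hx, Pi.one_apply, one_sub_ballAverage hr hm]
  · rw [indicator_of_notMem hx, zero_sub, enorm_neg]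

lemma exists_finite_measure_le_volume : ∃ μ : Measure E3, IsFiniteMeasure μ ∧ μ ≤ volume ∧
    (volume : Measure E3) ≪ μ := by
  have hInt : Integrable (fun x : E3 => (1 + ‖x‖) ^ (-(4:ℝ))) :=
    integrable_one_add_norm (by simp; norm_num)
  refine ⟨volume.withDensity fun x : E3 => ENNReal.ofReal ((1 + ‖x‖) ^ (-(4:ℝ))),
    isFiniteMeasure_withDensity_ofReal hInt.2, ?_, ?_⟩
  · conv_rhs => rw [← withDensity_one (μ := (volume : Measure E3))]
    refine withDensity_mono (.of_forall fun x => ?_)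
    simp only [Pi.one_apply, ENNReal.ofReal_le_one]
    exact Real.rpow_le_one_of_one_le_of_nonpos (by linarith [norm_nonneg x]) (by norm_num)
  · refine withDensity_absolutelyContinuous' hInt.1.aemeasurable.ennreal_ofReal
      (.of_forall fun x => ?_)
    simp only [ne_eq, ENNReal.ofReal_eq_zero, not_le]
    have : 0 < 1 + ‖x‖ := by linarith [norm_nonneg x]
    positivity

/-- Compactness of sets of bounded measure and perimeter with respect to almost everywhere
convergence. -/
theorem exists_subseq_ae_eventually_mem_iff {Ω : ℕ → Set E3} (hm : ∀ n, MeasurableSet (Ω n))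
    {A P : ℝ} (hA : ∀ n, volume (Ω n) ≤ ENNReal.ofReal A) (hf : ∀ n, FinitePerimeter 3 (Ω n))
    (hP : ∀ n, perimeter 3 (Ω n) ≤ P) :
    ∃ φ : ℕ → ℕ, StrictMono φ ∧ ∃ S : Set E3, MeasurableSet S ∧
      ∀ᵐ x, ∀ᶠ n in atTop, (x ∈ Ω (φ n) ↔ x ∈ S) := by
  have hv : ∀ n, volume (Ω n) ≠ ⊤ := fun n => ((hA n).trans_lt ENNReal.ofReal_lt_top).ne
  obtain ⟨φ, hφ, hlim⟩ := exists_subseq_tendsto_volume_inter hm hA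
  obtain ⟨μ, hμ, hμv, hvμ⟩ := exists_finite_measure_le_volume
  have hcauchy : ∀ ε : ENNReal, ε ≠ 0 → ∃ N, ∀ n ≥ N, ∀ m ≥ N,
      μ (symmDiff (Ω (φ n)) (Ω (φ m))) ≤ ε := by
    intro ε hε
    have hε4 : 0 < ε / 4 := ENNReal.div_pos hε (by simp)
    obtain ⟨r, hr, hrε⟩ : ∃ r : ℝ, 0 < r ∧ 2 * ENNReal.ofReal (P * r) < ε / 4 := by
      have : Tendsto (fun r : ℝ => 2 * ENNReal.ofReal (P * r)) (𝓝[>] 0) (𝓝 0) := by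
        have h : Continuous fun r : ℝ => 2 * ENNReal.ofReal (P * r) :=
          (ENNReal.continuous_const_mul (by simp)).comp
            (ENNReal.continuous_ofReal.comp (continuous_const_mul P))
        simpa using (h.tendsto 0).mono_left (nhdsWithin_le_nhds (s := Ioi 0))
      obtain ⟨r, h1, h2⟩ := ((this.eventually_lt_const hε4).and self_mem_nhdsWithin).exists
      exact ⟨r, h2, h1⟩
    have hlim' : ∀ x, ∃ l, Tendsto (fun n => ballAverage r (Ω (φ n)) x) atTop (𝓝 l) := by
      intro x
      obtain ⟨l, hl⟩ := hlim x r
      exact ⟨_, hl.div_const _⟩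
    choose F hF using hlim'
    have hmeas : ∀ n, Measurable (ballAverage r (Ω (φ n))) := fun n =>
      measurable_ballAverage r (hm _)
    have hFm : Measurable F := measurable_of_tendsto_metrizable hmeas (tendsto_pi_nhds.2 hF)
    have hFb : ∀ x, 0 ≤ F x ∧ F x ≤ 1 := fun x =>
      ⟨ge_of_tendsto' (hF x) fun n => ballAverage_nonneg _ _ _,
        le_of_tendsto' (hF x) fun n => ballAverage_le_one _ _ _⟩
    have hto : Tendsto (fun n => ∫⁻ x, ‖ballAverage r (Ω (φ n)) x - F x‖ₑ ∂μ) atTop (𝓝 0) := by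
      have h0 : (0 : ENNReal) = ∫⁻ x, 0 ∂μ := by simp
      rw [h0]
      refine tendsto_lintegral_of_dominated_convergence (fun _ => 1)
        (fun n => ((hmeas n).sub hFm).enorm) (fun n => .of_forall fun x => ?_) (by simp)
        (.of_forall fun x => ?_)
      · simp only
        rw [Real.enorm_eq_ofReal_abs, ENNReal.ofReal_le_one, abs_le]
        have := ballAverage_nonneg r (Ω (φ n)) x
        have := ballAverage_le_one r (Ω (φ n)) x
        constructor <;> linarith [(hFb x).1, (hFb x).2]
      · have := ((hF x).sub_const (F x)).enorm
        simpa using this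
    obtain ⟨N, hN⟩ := eventually_atTop.1 (hto.eventually_lt_const hε4)
    have hind : ∀ n, Measurable ((Ω (φ n)).indicator (1 : E3 → ℝ)) := fun n =>
      measurable_one.indicator (hm _)
    have hn : ∀ n ≥ N, ∫⁻ x, ‖(Ω (φ n)).indicator 1 x - F x‖ₑ ∂μ ≤ ε / 2 := by
      intro n hn
      calc ∫⁻ x, ‖(Ω (φ n)).indicator 1 x - F x‖ₑ ∂μ
          ≤ ∫⁻ x, (‖(Ω (φ n)).indicator 1 x - ballAverage r (Ω (φ n)) x‖ₑ
              + ‖ballAverage r (Ω (φ n)) x - F x‖ₑ) ∂μ := by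
            refine lintegral_mono fun x => ?_
            refine le_of_eq_of_le ?_ (enorm_add_le _ _)
            congr 1; ring
        _ = (∫⁻ x, ‖(Ω (φ n)).indicator 1 x - ballAverage r (Ω (φ n)) x‖ₑ ∂μ)
              + ∫⁻ x, ‖ballAverage r (Ω (φ n)) x - F x‖ₑ ∂μ :=
            lintegral_add_left ((hind n).sub (hmeas n)).enorm _
        _ ≤ ε / 4 + ε / 4 := by
            refine add_le_add ?_ (hN n hn).le
            refine (lintegral_mono' hμv le_rfl).trans ?_
            refine (lintegral_indicator_sub_ballAverage_le (hm _) (hf _) (hv _) hr).trans ?_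
            refine le_trans ?_ hrε.le
            gcongr
            exact hP _
        _ = ε / 2 := by
            rw [← two_mul, ENNReal.div_eq_inv_mul, ENNReal.div_eq_inv_mul, ← mul_assoc]
            congr 1
            rw [show (4 : ENNReal) = 2 * 2 by norm_num, ENNReal.mul_inv (by simp) (by simp),
              ← mul_assoc, ENNReal.mul_inv_cancel (by simp) (by simp), one_mul]
    refine ⟨N, fun n hnN m hmN => ?_⟩
    have hs : MeasurableSet (symmDiff (Ω (φ n)) (Ω (φ m))) := (hm _).symmDiff (hm _)
    calc μ (symmDiff (Ω (φ n)) (Ω (φ m)))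
        = ∫⁻ x, (symmDiff (Ω (φ n)) (Ω (φ m))).indicator 1 x ∂μ := (lintegral_indicator_one hs).symm
      _ ≤ ∫⁻ x, (‖(Ω (φ n)).indicator 1 x - F x‖ₑ + ‖(Ω (φ m)).indicator 1 x - F x‖ₑ) ∂μ := by
          refine lintegral_mono fun x => ?_
          have h1 := enorm_sub_le (E := ℝ) (a := (Ω (φ n)).indicator 1 x - F x)
            (b := (Ω (φ m)).indicator 1 x - F x)
          refine le_trans ?_ h1
          rw [sub_sub_sub_cancel_right]
          by_cases h2 : x ∈ Ω (φ n) <;> by_cases h3 : x ∈ Ω (φ m) <;>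
            simp [indicator, mem_symmDiff, h2, h3]
      _ = _ := lintegral_add_left ((hind n).sub hFm).enorm _
      _ ≤ ε / 2 + ε / 2 := add_le_add (hn n hnN) (hn m hmN)
      _ = ε := ENNReal.add_halves ε
  obtain ⟨ψ, hψ, hψd⟩ := extraction_forall_of_eventually'
    (P := fun k N => ∀ n ≥ N, ∀ m ≥ N, μ (symmDiff (Ω (φ n)) (Ω (φ m))) ≤ (2⁻¹ : ENNReal) ^ k)
    (fun k => by
      obtain ⟨N, hN⟩ := hcauchy ((2⁻¹ : ENNReal) ^ k) (by simp)
      exact ⟨N, fun M hM n hn m hm => hN n (hM.trans hn) m (hM.trans hm)⟩)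
  refine ⟨φ ∘ ψ, hφ.comp hψ, {x | ∀ᶠ n in atTop, x ∈ Ω (φ (ψ n))}, ?_, ?_⟩
  · have : {x | ∀ᶠ n in atTop, x ∈ Ω (φ (ψ n))} = liminf (fun n => Ω (φ (ψ n))) atTop := by
      ext x; rw [mem_liminf_iff_eventually_mem]; rfl
    rw [this]
    exact MeasurableSet.measurableSet_liminf fun n => hm _
  · have h1 : ∑' k, μ (symmDiff (Ω (φ (ψ k))) (Ω (φ (ψ (k + 1))))) ≠ ⊤ := by
      refine ne_top_of_le_ne_top ?_ (ENNReal.tsum_le_tsum fun k =>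
        hψd k _ le_rfl _ (hψ.monotone k.le_succ))
      simp [ENNReal.tsum_geometric]
    refine hvμ.ae_le ?_
    filter_upwards [ae_eventually_notMem h1] with x hx
    obtain ⟨N, hN⟩ := eventually_atTop.1 hx
    have h2 : ∀ n ≥ N, (x ∈ Ω (φ (ψ n)) ↔ x ∈ Ω (φ (ψ N))) := by
      intro n hn
      induction n, hn using Nat.le_induction with
      | base => rfl
      | succ n hn ih =>
        have := hN n hn
        rw [mem_symmDiff] at this
        tauto
    filter_upwards [eventually_ge_atTop N] with n hn
    refine (h2 n hn).trans ?_
    constructor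
    · intro h
      exact eventually_atTop.2 ⟨N, fun m hm => (h2 m hm).2 h⟩
    · intro h
      obtain ⟨m, h3, h4⟩ := (h.and (eventually_ge_atTop N)).exists
      exact (h2 m h4).1 h3

/-- The Coulomb interaction as a Lebesgue integral with values in `[0, ∞]`. -/
def coulombLintegral (S : Set E3) : ENNReal :=
  ∫⁻ x in S, ∫⁻ y in S, ENNReal.ofReal ‖x - y‖⁻¹

lemma measurable_coulombKernel :
    Measurable (fun p : E3 × E3 => ENNReal.ofReal ‖p.1 - p.2‖⁻¹) :=
  ((measurable_fst.sub measurable_snd).norm.inv).ennreal_ofReal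

lemma measurable_coulombPotential (S : Set E3) :
    Measurable (fun x : E3 => ∫⁻ y in S, ENNReal.ofReal ‖x - y‖⁻¹) :=
  measurable_coulombKernel.lintegral_prod_right'

lemma exists_coulombPotential_le : ∃ C : ENNReal, C ≠ ⊤ ∧ ∀ (S : Set E3) (x : E3),
    ∫⁻ y in S, ENNReal.ofReal ‖x - y‖⁻¹ ≤ C + volume S := by
  have hInt : IntegrableOn (fun z : E3 => ‖z‖⁻¹) (ball 0 1) :=
    integrableOn_ball_of_norm_le_rpow (C := 1) (α := 1) (by simp) (by simp)
      (.of_forall fun x => by simp [Real.rpow_neg_one])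
      measurable_norm.inv.aestronglyMeasurable
  have hfin : ∫⁻ z in ball (0 : E3) 1, ENNReal.ofReal ‖z‖⁻¹ ≠ ⊤ := by
    have := hInt.2
    rw [hasFiniteIntegral_iff_ofReal (.of_forall fun x => by positivity)] at this
    exact this.ne
  refine ⟨_, hfin, fun S x => ?_⟩
  let g : E3 → ENNReal := (ball (0 : E3) 1).indicator fun z => ENNReal.ofReal ‖z‖⁻¹
  have hg : Measurable g := (measurable_norm.inv.ennreal_ofReal).indicator measurableSet_ball
  calc ∫⁻ y in S, ENNReal.ofReal ‖x - y‖⁻¹ ≤ ∫⁻ y in S, (g (y - x) + 1) := by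
        refine lintegral_mono fun y => ?_
        by_cases h : y - x ∈ ball (0 : E3) 1
        · simp only [g, indicator_of_mem h, norm_sub_rev x y]
          exact le_self_add
        · simp only [g, indicator_of_notMem h, zero_add, ENNReal.ofReal_le_one]
          rw [mem_ball_zero_iff, not_lt, norm_sub_rev] at h
          exact inv_le_one_of_one_le₀ h
    _ = (∫⁻ y in S, g (y - x)) + volume S := by
        rw [lintegral_add_right _ measurable_const]
        simp
    _ ≤ (∫⁻ y, g (y - x)) + volume S := by
        gcongr
        exact Measure.restrict_le_self
    _ = _ := by
        rw [lintegral_sub_right_eq_self g x, lintegral_indicator measurableSet_ball]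

lemma coulombPotential_ne_top {S : Set E3} (hS : volume S ≠ ⊤) (x : E3) :
    ∫⁻ y in S, ENNReal.ofReal ‖x - y‖⁻¹ ≠ ⊤ := by
  obtain ⟨C, hC, h⟩ := exists_coulombPotential_le
  exact ne_top_of_le_ne_top (ENNReal.add_ne_top.2 ⟨hC, hS⟩) (h S x)

lemma coulombLintegral_ne_top {S : Set E3} (hS : volume S ≠ ⊤) : coulombLintegral S ≠ ⊤ := by
  obtain ⟨C, hC, h⟩ := exists_coulombPotential_le
  refine ne_top_of_le_ne_top ?_ (lintegral_mono fun x => h S x)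
  rw [setLIntegral_const]
  exact ENNReal.mul_ne_top (ENNReal.add_ne_top.2 ⟨hC, hS⟩) hS

lemma coulomb_eq {S : Set E3} (hS : volume S ≠ ⊤) :
    coulomb S = (1 / 2) * (coulombLintegral S).toReal := by
  have h1 : ∀ x : E3, ∫ y in S, ‖x - y‖⁻¹ = (∫⁻ y in S, ENNReal.ofReal ‖x - y‖⁻¹).toReal :=
    fun x => integral_eq_lintegral_of_nonneg_ae (.of_forall fun y => by positivity)
      ((measurable_const.sub measurable_id).norm.inv.aestronglyMeasurable)
  unfold coulomb coulombLintegral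
  simp_rw [h1]
  rw [integral_toReal (measurable_coulombPotential S).aemeasurable
    (.of_forall fun x => (coulombPotential_ne_top hS x).lt_top)]

lemma coulomb_nonneg (S : Set E3) : 0 ≤ coulomb S := by
  unfold coulomb
  positivity

/-- The Coulomb energy is superadditive. -/
lemma coulomb_inter_add_diff_le {S T : Set E3} (hS : volume S ≠ ⊤) (hT : MeasurableSet T) :
    coulomb (S ∩ T) + coulomb (S \ T) ≤ coulomb S := by
  have h1 : volume (S ∩ T) ≠ ⊤ := measure_ne_top_of_subset inter_subset_left hS
  have h2 : volume (S \ T) ≠ ⊤ := measure_ne_top_of_subset sdiff_subset hS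
  rw [coulomb_eq hS, coulomb_eq h1, coulomb_eq h2, ← mul_add,
    ← ENNReal.toReal_add (coulombLintegral_ne_top h1) (coulombLintegral_ne_top h2)]
  refine mul_le_mul_of_nonneg_left (ENNReal.toReal_mono (coulombLintegral_ne_top hS) ?_)
    (by norm_num)
  unfold coulombLintegral
  rw [← lintegral_inter_add_sdiff _ S hT]
  exact add_le_add
    (lintegral_mono fun x => lintegral_mono_set inter_subset_left)
    (lintegral_mono fun x => lintegral_mono_set sdiff_subset)

lemma coulombLintegral_eq_lintegral_indicator {S : Set E3} (hS : MeasurableSet S) :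
    coulombLintegral S =
      ∫⁻ x, S.indicator 1 x * ∫⁻ y, S.indicator 1 y * ENNReal.ofReal ‖x - y‖⁻¹ := by
  unfold coulombLintegral
  rw [← lintegral_indicator hS]
  refine lintegral_congr fun x => ?_
  by_cases hx : x ∈ S
  · simp only [indicator_of_mem hx, Pi.one_apply, one_mul]
    rw [← lintegral_indicator hS]
    refine lintegral_congr fun y => ?_
    by_cases hy : y ∈ S <;> simp [hy]
  · simp [hx]

lemma coulombLintegral_le_liminf {T : ℕ → Set E3} {S : Set E3} (hT : ∀ n, MeasurableSet (T n))
    (hS : MeasurableSet S) (h : ∀ᵐ x, ∀ᶠ n in atTop, (x ∈ T n ↔ x ∈ S)) :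
    coulombLintegral S ≤ liminf (fun n => coulombLintegral (T n)) atTop := by
  have hk : ∀ x : E3, Measurable fun y : E3 => ENNReal.ofReal ‖x - y‖⁻¹ := fun x =>
    (measurable_const.sub measurable_id).norm.inv.ennreal_ofReal
  have hind : ∀ n, Measurable ((T n).indicator (1 : E3 → ENNReal)) :=
    fun n => measurable_one.indicator (hT n)
  have hinner : ∀ x : E3, ∫⁻ y, S.indicator 1 y * ENNReal.ofReal ‖x - y‖⁻¹ ≤
      liminf (fun n => ∫⁻ y, (T n).indicator 1 y * ENNReal.ofReal ‖x - y‖⁻¹) atTop := by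
    intro x
    have hpt : ∀ᵐ y, S.indicator (1 : E3 → ENNReal) y * ENNReal.ofReal ‖x - y‖⁻¹ ≤
        liminf (fun n => (T n).indicator (1 : E3 → ENNReal) y * ENNReal.ofReal ‖x - y‖⁻¹)
          atTop := by
      filter_upwards [h] with y hy
      by_cases hyS : y ∈ S
      · refine le_liminf_of_le (by isBoundedDefault) ?_
        filter_upwards [hy] with n hn
        simp [hyS, hn.2 hyS]
      · simp [hyS]
    exact (lintegral_mono_ae hpt).trans
      (lintegral_liminf_le fun n => (hind n).mul (hk x))
  have hm : ∀ n, Measurable fun x : E3 =>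
      ∫⁻ y, (T n).indicator 1 y * ENNReal.ofReal ‖x - y‖⁻¹ := fun n =>
    Measurable.lintegral_prod_right'
      (f := fun p : E3 × E3 => (T n).indicator 1 p.2 * ENNReal.ofReal ‖p.1 - p.2‖⁻¹)
      (((hind n).comp measurable_snd).mul measurable_coulombKernel)
  rw [coulombLintegral_eq_lintegral_indicator hS]
  simp_rw [fun n => coulombLintegral_eq_lintegral_indicator (hT n)]
  refine le_trans (lintegral_mono_ae ?_) (lintegral_liminf_le fun n => (hind n).mul (hm n))
  filter_upwards [h] with x hx
  by_cases hxS : x ∈ S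
  · simp only [indicator_of_mem hxS, Pi.one_apply, one_mul]
    refine (hinner x).trans (le_of_eq (liminf_congr ?_))
    filter_upwards [hx] with n hn
    simp [hn.2 hxS]
  · simp [hxS]

/-- The Coulomb energy is lower semicontinuous under almost everywhere convergence. -/
lemma coulomb_le_of_tendsto {T : ℕ → Set E3} {S : Set E3} (hT : ∀ n, MeasurableSet (T n))
    (hS : MeasurableSet S) (hTv : ∀ n, volume (T n) ≠ ⊤) (hSv : volume S ≠ ⊤)
    (h : ∀ᵐ x, ∀ᶠ n in atTop, (x ∈ T n ↔ x ∈ S)) {a : ℕ → ℝ} {l : ℝ}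
    (ha : Tendsto a atTop (𝓝 l)) (hle : ∀ n, coulomb (T n) ≤ a n) : coulomb S ≤ l := by
  have hle' : ∀ n, coulombLintegral (T n) ≤ ENNReal.ofReal (2 * a n) := by
    intro n
    have := hle n
    rw [coulomb_eq (hTv n)] at this
    rw [ENNReal.le_ofReal_iff_toReal_le (coulombLintegral_ne_top (hTv n))
      (by linarith [coulomb_nonneg (T n), hle n])]
    linarith
  have hlim : Tendsto (fun n => ENNReal.ofReal (2 * a n)) atTop (𝓝 (ENNReal.ofReal (2 * l))) :=
    ENNReal.tendsto_ofReal (ha.const_mul 2)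
  have h3 : coulombLintegral S ≤ ENNReal.ofReal (2 * l) := by
    rw [← hlim.liminf_eq]
    exact (coulombLintegral_le_liminf hT hS h).trans (liminf_le_liminf (.of_forall hle'))
  have hl : 0 ≤ l := ge_of_tendsto' ha fun n => (coulomb_nonneg _).trans (hle n)
  rw [coulomb_eq hSv]
  have h4 := ENNReal.toReal_mono ENNReal.ofReal_ne_top h3
  rw [ENNReal.toReal_ofReal (by positivity)] at h4
  linarith

lemma coulomb_translate (S : Set E3) (a : E3) : coulomb ((· + a) ⁻¹' S) = coulomb S := by
  have hmp : MeasurePreserving (fun x : E3 => x + a) volume volume :=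
    measurePreserving_add_right volume a
  have hme : MeasurableEmbedding (fun x : E3 => x + a) := measurableEmbedding_addRight a
  unfold coulomb
  congr 1
  rw [← hmp.setIntegral_preimage_emb hme (fun x => ∫ y in S, ‖x - y‖⁻¹) S]
  congr 1
  ext x
  rw [← hmp.setIntegral_preimage_emb hme (fun y => ‖x + a - y‖⁻¹) S]
  simp

lemma perSet_translate_subset (S : Set E3) (a : E3) : perSet 3 ((· + a) ⁻¹' S) ⊆ perSet 3 S := by
  have hmp : MeasurePreserving (fun x : E3 => x + a) volume volume :=
    measurePreserving_add_right volume a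
  have hme : MeasurableEmbedding (fun x : E3 => x + a) := measurableEmbedding_addRight a
  rintro _ ⟨F, h1, h2, h3, rfl⟩
  refine ⟨fun x => F (x - a), h1.comp (contDiff_id.sub contDiff_const), ?_, fun x => h3 _, ?_⟩
  · exact h2.comp_homeomorph (Homeomorph.subRight a)
  · rw [← hmp.setIntegral_preimage_emb hme _ S]
    simp [fderiv_comp_sub]

lemma finitePerimeter_translate {S : Set E3} (hS : FinitePerimeter 3 S) (a : E3) :
    FinitePerimeter 3 ((· + a) ⁻¹' S) :=
  hS.mono (perSet_translate_subset S a)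

lemma perimeter_translate_le {S : Set E3} (hS : FinitePerimeter 3 S) (a : E3) :
    perimeter 3 ((· + a) ⁻¹' S) ≤ perimeter 3 S :=
  perimeter_le_of_forall_le fun F hF =>
    le_csSup hS (perSet_translate_subset S a ⟨F, hF.1, hF.2, hF.3, rfl⟩)


/-- A smooth substitute for the norm. -/
def japaneseBracket (x : E3) : ℝ := √(1 + ‖x‖ ^ 2)

lemma contDiff_japaneseBracket : ContDiff ℝ 1 japaneseBracket :=
  (contDiff_const.add (contDiff_norm_sq ℝ)).sqrt fun x => by positivity

lemma continuous_japaneseBracket : Continuous japaneseBracket :=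
  contDiff_japaneseBracket.continuous

lemma norm_le_japaneseBracket (x : E3) : ‖x‖ ≤ japaneseBracket x :=
  Real.le_sqrt_of_sq_le (by linarith)

lemma japaneseBracket_sq (x : E3) : japaneseBracket x ^ 2 = 1 + ‖x‖ ^ 2 :=
  Real.sq_sqrt (by positivity)

lemma norm_fderiv_japaneseBracket_le (x : E3) : ‖fderiv ℝ japaneseBracket x‖ ≤ 1 := by
  have h : LipschitzWith 1 japaneseBracket := by
    refine LipschitzWith.of_le_add fun x y => ?_
    rw [dist_eq_norm]
    have h1 : ‖x‖ ≤ ‖y‖ + ‖x - y‖ := by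
      simpa using norm_add_le y (x - y)
    have h2 := japaneseBracket_sq y
    have h3 := norm_le_japaneseBracket y
    refine Real.sqrt_le_iff.2 ⟨add_nonneg (Real.sqrt_nonneg _) (norm_nonneg _), ?_⟩
    nlinarith [norm_nonneg x, norm_nonneg (x - y), norm_nonneg y]
  simpa using norm_fderiv_le_of_lipschitz ℝ h (x₀ := x)

lemma measurableSet_japaneseBracket_le (R : ℝ) : MeasurableSet {x | japaneseBracket x ≤ R} :=
  measurableSet_le continuous_japaneseBracket.measurable measurable_const

lemma japaneseBracket_sublevel_subset (R : ℝ) :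
    {x | japaneseBracket x ≤ R} ⊆ closedBall 0 R := fun x hx => by
  simpa using (norm_le_japaneseBracket x).trans hx

lemma volume_japaneseBracket_le_ne_top (R : ℝ) : volume {x | japaneseBracket x ≤ R} ≠ ⊤ :=
  ((measure_mono (japaneseBracket_sublevel_subset R)).trans_lt measure_closedBall_lt_top).ne

lemma ae_japaneseBracket_ne (R : ℝ) : ∀ᵐ x, japaneseBracket x ≠ R := by
  have h : {x : E3 | ¬ japaneseBracket x ≠ R} ⊆ sphere 0 (√(R ^ 2 - 1)) := fun x hx => by
    simp only [ne_eq, not_not, mem_ofPred_eq] at hx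
    have := japaneseBracket_sq x
    rw [hx] at this
    simp [this, Real.sqrt_sq]
  exact measure_mono_null h (Measure.addHaar_sphere _ _ _)

lemma deriv_smoothTransition_eq_zero {t : ℝ} (ht : t ≤ 0 ∨ 1 ≤ t) :
    deriv Real.smoothTransition t = 0 := by
  rcases ht with h | h
  · exact IsLocalMin.deriv_eq_zero (Eventually.of_forall fun s => by
      simpa [Real.smoothTransition.zero_of_nonpos h] using Real.smoothTransition.nonneg s)
  · exact IsLocalMax.deriv_eq_zero (Eventually.of_forall fun s => by
      simpa [Real.smoothTransition.one_of_one_le h] using Real.smoothTransition.le_one s)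

lemma exists_abs_deriv_smoothTransition_le :
    ∃ C, 0 ≤ C ∧ ∀ t, |deriv Real.smoothTransition t| ≤ C := by
  have hd : Continuous (deriv Real.smoothTransition) :=
    (Real.smoothTransition.contDiff (n := 1)).continuous_deriv_one
  obtain ⟨C, hC⟩ := (isCompact_Icc (a := (0:ℝ)) (b := 1)).exists_bound_of_continuousOn
    hd.continuousOn
  have hC0 : 0 ≤ C := (norm_nonneg _).trans (hC 0 (by simp))
  refine ⟨C, hC0, fun t => ?_⟩
  by_cases ht : t ≤ 0 ∨ 1 ≤ t
  · simpa [deriv_smoothTransition_eq_zero ht] using hC0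
  · push Not at ht
    exact hC t ⟨ht.1.le, ht.2.le⟩

/-- A cutoff equal to `0` where the bracket is at most `R` and to `1` where it is at least `z`. -/
def radialCutoff (R z : ℝ) (x : E3) : ℝ :=
  Real.smoothTransition ((japaneseBracket x - R) / (z - R))

lemma contDiff_radialCutoff (R z : ℝ) : ContDiff ℝ 1 (radialCutoff R z) :=
  Real.smoothTransition.contDiff.comp ((contDiff_japaneseBracket.sub contDiff_const).div_const _)

lemma radialCutoff_of_le {R z : ℝ} (h : R < z) {x : E3} (hx : japaneseBracket x ≤ R) :
    radialCutoff R z x = 0 :=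
  Real.smoothTransition.zero_of_nonpos (div_nonpos_of_nonpos_of_nonneg (by linarith) (by linarith))

lemma radialCutoff_of_ge {R z : ℝ} (h : R < z) {x : E3} (hx : z ≤ japaneseBracket x) :
    radialCutoff R z x = 1 :=
  Real.smoothTransition.one_of_one_le ((one_le_div (by linarith)).2 (by linarith))

lemma fderiv_radialCutoff_apply (R z : ℝ) (x v : E3) :
    fderiv ℝ (radialCutoff R z) x v =
      deriv Real.smoothTransition ((japaneseBracket x - R) / (z - R)) *
        (fderiv ℝ japaneseBracket x v / (z - R)) := by
  have h1 : HasFDerivAt (fun x => (japaneseBracket x - R) * (z - R)⁻¹)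
      ((z - R)⁻¹ • fderiv ℝ japaneseBracket x) x :=
    (((contDiff_japaneseBracket.differentiable one_ne_zero x).hasFDerivAt).sub_const R).mul_const _
  have h2 : HasDerivAt Real.smoothTransition
      (deriv Real.smoothTransition ((japaneseBracket x - R) * (z - R)⁻¹))
      ((japaneseBracket x - R) * (z - R)⁻¹) :=
    ((Real.smoothTransition.contDiff (n := 1)).differentiable one_ne_zero _).hasDerivAt
  have h3 : HasFDerivAt (radialCutoff R z) _ x := h2.comp_hasFDerivAt x h1
  rw [h3.fderiv]
  simp [div_eq_mul_inv]
  ring_nf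
  simp

lemma abs_fderiv_radialCutoff_le {C : ℝ} (hC : ∀ t, |deriv Real.smoothTransition t| ≤ C)
    {R z : ℝ} (h : R < z) (x v : E3) :
    |fderiv ℝ (radialCutoff R z) x v| ≤
      {x | R < japaneseBracket x ∧ japaneseBracket x ≤ z}.indicator
        (fun _ => C / (z - R) * ‖v‖) x := by
  have hC0 : 0 ≤ C := (abs_nonneg _).trans (hC 0)
  have hz : 0 < z - R := sub_pos.2 h
  rw [fderiv_radialCutoff_apply]
  by_cases hx : x ∈ {x | R < japaneseBracket x ∧ japaneseBracket x ≤ z}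
  · rw [indicator_of_mem hx, abs_mul, abs_div, abs_of_pos hz]
    have h1 : |fderiv ℝ japaneseBracket x v| ≤ ‖v‖ :=
      ((fderiv ℝ japaneseBracket x).le_opNorm v).trans
        (mul_le_of_le_one_left (norm_nonneg _) (norm_fderiv_japaneseBracket_le x))
    calc _ ≤ C * (‖v‖ / (z - R)) := by gcongr; exact hC _
      _ = _ := by ring
  · rw [indicator_of_notMem hx, deriv_smoothTransition_eq_zero]
    · simp
    · simp only [mem_ofPred_eq, not_and_or, not_lt, not_le] at hx
      rcases hx with hx | hx
      · exact Or.inl (div_nonpos_of_nonpos_of_nonneg (by linarith) hz.le)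
      · exact Or.inr ((one_le_div hz).2 (by linarith))

/-- Gluing two admissible fields along a thin shell. -/
lemma setIntegral_glue_le {C : ℝ} (hC : ∀ t, |deriv Real.smoothTransition t| ≤ C)
    {Ω : Set E3} (hm : MeasurableSet Ω) (hP : FinitePerimeter 3 Ω) {F₁ F₂ : E3 → E3}
    (h₁ : Admissible F₁) (h₂ : Admissible F₂) {R z : ℝ} (h : R < z) :
    ∫ x in Ω, (dvg F₁ x + radialCutoff R z x * (dvg F₂ x - dvg F₁ x)) ≤
      perimeter 3 Ω + 2 * C *
        slope (fun s => volume.real (Ω ∩ {x | japaneseBracket x ≤ s})) R z := by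
  have hC0 : 0 ≤ C := (abs_nonneg _).trans (hC 0)
  have hz : 0 < z - R := sub_pos.2 h
  set χ := radialCutoff R z with hχ
  have hχc : ContDiff ℝ 1 χ := contDiff_radialCutoff R z
  have hχ0 : ∀ x, 0 ≤ χ x := fun x => Real.smoothTransition.nonneg _
  have hχ1 : ∀ x, χ x ≤ 1 := fun x => Real.smoothTransition.le_one _
  have hsub : ContDiff ℝ 1 (fun y => F₂ y - F₁ y) := h₂.contDiff.sub h₁.contDiff
  have hsm : ContDiff ℝ 1 (fun y => χ y • (F₂ y - F₁ y)) := hχc.smul hsub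
  have hG : Admissible (fun y => F₁ y + χ y • (F₂ y - F₁ y)) := by
    refine ⟨h₁.contDiff.add hsm, ?_, fun x => ?_⟩
    · exact h₁.compact.add (HasCompactSupport.smul_left (f := χ) (h₂.compact.sub h₁.compact))
    · have : F₁ x + χ x • (F₂ x - F₁ x) = (1 - χ x) • F₁ x + χ x • F₂ x := by
        rw [smul_sub, sub_smul, one_smul]; abel
      rw [this]
      refine (norm_add_le _ _).trans ?_
      rw [norm_smul, norm_smul, Real.norm_of_nonneg (hχ0 x),
        Real.norm_of_nonneg (sub_nonneg.2 (hχ1 x))]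
      nlinarith [h₁.norm_le x, h₂.norm_le x, hχ0 x, hχ1 x]
  have hdG : ∀ x, dvg (fun y => F₁ y + χ y • (F₂ y - F₁ y)) x =
      dvg F₁ x + χ x * (dvg F₂ x - dvg F₁ x) + fderiv ℝ χ x (F₂ x - F₁ x) := fun x => by
    rw [dvg_add (h₁.contDiff.differentiable one_ne_zero x) (hsm.differentiable one_ne_zero x),
      dvg_smul (g := χ) (F := fun y => F₂ y - F₁ y) (hχc.differentiable one_ne_zero x)
        (hsub.differentiable one_ne_zero x),
      dvg_sub (h₂.contDiff.differentiable one_ne_zero x)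
        (h₁.contDiff.differentiable one_ne_zero x)]
    ring
  have hS : MeasurableSet {x | R < japaneseBracket x ∧ japaneseBracket x ≤ z} :=
    (measurableSet_lt measurable_const continuous_japaneseBracket.measurable).inter
      (measurableSet_japaneseBracket_le z)
  have hSf : volume {x | R < japaneseBracket x ∧ japaneseBracket x ≤ z} ≠ ⊤ :=
    ne_top_of_le_ne_top (volume_japaneseBracket_le_ne_top z) (measure_mono fun x hx => hx.2)
  have hi1 : Integrable (fun x => dvg F₁ x + χ x * (dvg F₂ x - dvg F₁ x)) := by
    have hd : Continuous fun x => dvg F₂ x - dvg F₁ x :=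
      (continuous_dvg h₂.contDiff).sub (continuous_dvg h₁.contDiff)
    refine (integrable_dvg h₁.contDiff h₁.compact).add
      ((hχc.continuous.mul hd).integrable_of_hasCompactSupport ?_)
    exact HasCompactSupport.mul_left (f := χ)
      ((hasCompactSupport_dvg h₂.compact).sub (hasCompactSupport_dvg h₁.compact))
  have hi2 : Integrable ({x | R < japaneseBracket x ∧ japaneseBracket x ≤ z}.indicator
      (fun _ : E3 => 2 * C / (z - R))) :=
    (integrable_indicator_iff hS).2 (integrableOn_const hSf)
  have hle : ∀ x, dvg F₁ x + χ x * (dvg F₂ x - dvg F₁ x) ≤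
      dvg (fun y => F₁ y + χ y • (F₂ y - F₁ y)) x +
        {x | R < japaneseBracket x ∧ japaneseBracket x ≤ z}.indicator
          (fun _ => 2 * C / (z - R)) x := fun x => by
    have hb : |fderiv ℝ χ x (F₂ x - F₁ x)| ≤
        {x | R < japaneseBracket x ∧ japaneseBracket x ≤ z}.indicator
          (fun _ => 2 * C / (z - R)) x := by
      refine (abs_fderiv_radialCutoff_le hC h x _).trans ?_
      refine indicator_le_indicator ?_
      have : ‖F₂ x - F₁ x‖ ≤ 2 :=
        (norm_sub_le _ _).trans (by linarith [h₁.norm_le x, h₂.norm_le x])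
      calc _ ≤ C / (z - R) * 2 := by gcongr
        _ = _ := by ring
    rw [hdG x]
    linarith [neg_abs_le (fderiv ℝ χ x (F₂ x - F₁ x))]
  have hslope : slope (fun s => volume.real (Ω ∩ {x | japaneseBracket x ≤ s})) R z =
      volume.real (Ω ∩ {x | R < japaneseBracket x ∧ japaneseBracket x ≤ z}) / (z - R) := by
    rw [slope_def_field]
    congr 1
    have he : Ω ∩ {x | R < japaneseBracket x ∧ japaneseBracket x ≤ z} =
        (Ω ∩ {x | japaneseBracket x ≤ z}) \ (Ω ∩ {x | japaneseBracket x ≤ R}) := by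
      ext x; simp only [mem_inter_iff, mem_ofPred_eq, Set.mem_sdiff]; grind
    have hs : Ω ∩ {x | japaneseBracket x ≤ R} ⊆ Ω ∩ {x | japaneseBracket x ≤ z} :=
      inter_subset_inter_right _ fun x hx => le_trans hx h.le
    rw [he, measureReal_sdiff hs (hm.inter (measurableSet_japaneseBracket_le R))
      (ne_top_of_le_ne_top (volume_japaneseBracket_le_ne_top z) (measure_mono inter_subset_right))]
  calc ∫ x in Ω, (dvg F₁ x + χ x * (dvg F₂ x - dvg F₁ x))
      ≤ ∫ x in Ω, (dvg (fun y => F₁ y + χ y • (F₂ y - F₁ y)) x +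
        {x | R < japaneseBracket x ∧ japaneseBracket x ≤ z}.indicator
          (fun _ => 2 * C / (z - R)) x) :=
        integral_mono hi1.integrableOn
          ((integrable_dvg hG.contDiff hG.compact).add hi2).integrableOn hle
    _ = (∫ x in Ω, dvg (fun y => F₁ y + χ y • (F₂ y - F₁ y)) x) +
        volume.real (Ω ∩ {x | R < japaneseBracket x ∧ japaneseBracket x ≤ z}) *
          (2 * C / (z - R)) := by
        rw [integral_add (integrable_dvg hG.contDiff hG.compact).integrableOn hi2.integrableOn,
          setIntegral_indicator hS, setIntegral_const, smul_eq_mul]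
    _ ≤ perimeter 3 Ω +
        volume.real (Ω ∩ {x | R < japaneseBracket x ∧ japaneseBracket x ≤ z}) *
          (2 * C / (z - R)) := by
        gcongr; exact setIntegral_dvg_le hP hG
    _ = _ := by rw [hslope]; ring

lemma exists_frequently_slope_le {m : ℝ → ℝ} (hm : Continuous m) {a b c : ℝ} (hab : a < b)
    (h : m b - m a < c * (b - a)) :
    ∃ R ∈ Ico a b, ∃ᶠ z in 𝓝[>] R, slope m R z ≤ c := by
  by_contra! hne
  have hne' : ∀ R ∈ Ico a b, ∀ᶠ z in 𝓝[>] R, c < slope m R z := fun R hR => by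
    simpa [not_frequently] using hne R hR
  have key := image_le_of_liminf_slope_right_le_deriv_boundary (f := fun x => -m x) (a := a)
    (b := b) hm.neg.continuousOn (B := fun x => -m a - c * (x - a)) (B' := fun _ => -c)
    (by simp) (by fun_prop) (fun x _ => by
      have := (((hasDerivAt_id x).sub_const a).const_mul c).const_sub (-m a)
      simpa using this.hasDerivWithinAt)
    (fun x hx r hr => ((hne' x hx).mono fun z hz => by
      have : slope (fun x => -m x) x z = -slope m x z := by
        simp only [slope_def_field]; ring
      rw [this]; linarith).frequently)
  have := key (right_mem_Icc.2 hab.le)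
  linarith

lemma continuous_volume_inter_sublevel {Ω : Set E3} (hm : MeasurableSet Ω) :
    Continuous fun s => volume.real (Ω ∩ {x | japaneseBracket x ≤ s}) := by
  have hms : ∀ s, MeasurableSet (Ω ∩ {x | japaneseBracket x ≤ s}) := fun s =>
    hm.inter (measurableSet_japaneseBracket_le s)
  have he : (fun s => volume.real (Ω ∩ {x | japaneseBracket x ≤ s})) =
      fun s => ∫ x, (Ω ∩ {x | japaneseBracket x ≤ s}).indicator (fun _ => (1:ℝ)) x := by
    ext s; rw [integral_indicator (hms s)]; simp
  rw [he, continuous_iff_continuousAt]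
  intro s
  refine continuousAt_of_dominated
    (bound := {x | japaneseBracket x ≤ s + 1}.indicator fun _ => (1:ℝ))
    (Eventually.of_forall fun t => (measurable_const.indicator (hms t)).aestronglyMeasurable)
    ?_ ?_ ?_
  · filter_upwards [Iio_mem_nhds (show s < s + 1 by linarith)] with t ht
    refine Eventually.of_forall fun x => ?_
    rw [norm_indicator_eq_indicator_norm]
    simp only [norm_one]
    have hsub : Ω ∩ {x | japaneseBracket x ≤ t} ⊆ {x | japaneseBracket x ≤ s + 1} :=
      fun y hy => le_trans (show japaneseBracket y ≤ t from hy.2) (mem_Iio.1 ht).le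
    exact indicator_le_indicator_of_subset hsub (fun _ => zero_le_one) x
  · exact (integrable_indicator_iff (measurableSet_japaneseBracket_le _)).2
      (integrableOn_const (volume_japaneseBracket_le_ne_top _))
  · filter_upwards [ae_japaneseBracket_ne s] with x hx
    by_cases hxΩ : x ∈ Ω
    · rcases lt_or_gt_of_ne hx with h | h
      · refine continuousAt_const.congr (f := fun _ => (1:ℝ)) ?_
        filter_upwards [Ioi_mem_nhds h] with t ht
        have hxt : x ∈ Ω ∩ {x | japaneseBracket x ≤ t} := ⟨hxΩ, (mem_Ioi.1 ht).le⟩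
        simp only [indicator_of_mem hxt]
      · refine continuousAt_const.congr (f := fun _ => (0:ℝ)) ?_
        filter_upwards [Iio_mem_nhds h] with t ht
        exact (indicator_of_notMem (fun hx' => absurd (show japaneseBracket x ≤ t from hx'.2) (not_le.2 ht)) _).symm
    · refine continuousAt_const.congr (f := fun _ => (0:ℝ)) (Eventually.of_forall fun t => ?_)
      exact (indicator_of_notMem (fun hx' => hxΩ hx'.1) _).symm

lemma tendsto_setIntegral_glue (Ω : Set E3) {f₁ f₂ : E3 → ℝ}
    (hf₁ : Integrable f₁) (hf₂ : Integrable f₂) (R : ℝ) :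
    Tendsto (fun z => ∫ x in Ω, (f₁ x + radialCutoff R z x * (f₂ x - f₁ x))) (𝓝[>] R)
      (𝓝 ((∫ x in Ω ∩ {x | japaneseBracket x ≤ R}, f₁ x) +
        ∫ x in Ω \ {x | japaneseBracket x ≤ R}, f₂ x)) := by
  set T := {x | japaneseBracket x ≤ R} with hT
  have hTm : MeasurableSet T := measurableSet_japaneseBracket_le R
  have hlim : (∫ x in Ω ∩ T, f₁ x) + ∫ x in Ω \ T, f₂ x =
      ∫ x in Ω, (T.indicator f₁ x + Tᶜ.indicator f₂ x) := by
    rw [integral_add (hf₁.indicator hTm).integrableOn (hf₂.indicator hTm.compl).integrableOn,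
      setIntegral_indicator hTm, setIntegral_indicator hTm.compl]
    rfl
  rw [hlim]
  refine tendsto_integral_filter_of_dominated_convergence (fun x => |f₁ x| + |f₂ x - f₁ x|)
    ?_ ?_ ?_ ?_
  · refine Eventually.of_forall fun z => (hf₁.aestronglyMeasurable.add
      ((contDiff_radialCutoff R z).continuous.aestronglyMeasurable.mul
        (hf₂.sub hf₁).aestronglyMeasurable)).restrict
  · refine Eventually.of_forall fun z => Eventually.of_forall fun x => ?_
    refine (abs_add_le _ _).trans (add_le_add_right ?_ _)
    rw [abs_mul]
    refine mul_le_of_le_one_left (abs_nonneg _) ?_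
    have h0 : 0 ≤ radialCutoff R z x := Real.smoothTransition.nonneg _
    rw [abs_of_nonneg h0]
    exact Real.smoothTransition.le_one _
  · exact (hf₁.abs.add (hf₂.sub hf₁).abs).integrableOn
  · refine Eventually.of_forall fun x => ?_
    by_cases hx : x ∈ T
    · refine tendsto_const_nhds.congr' ?_
      filter_upwards [self_mem_nhdsWithin] with z hz
      simp [hx, radialCutoff_of_le hz hx]
    · refine tendsto_const_nhds.congr' ?_
      filter_upwards [self_mem_nhdsWithin, mem_nhdsWithin_of_mem_nhds
        (Iio_mem_nhds (not_le.1 hx))] with z hz hz'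
      simp [hx, radialCutoff_of_ge hz (le_of_lt hz')]

/-- Among the cuts by sublevels in a range of radii there is one whose cost is controlled by the
average slope of the mass. -/
lemma exists_cut : ∃ C : ℝ, 0 ≤ C ∧ ∀ (Ω : Set E3), MeasurableSet Ω → FinitePerimeter 3 Ω →
    ∀ a b c : ℝ, a < b →
      volume.real (Ω ∩ {x | japaneseBracket x ≤ b}) -
        volume.real (Ω ∩ {x | japaneseBracket x ≤ a}) < c * (b - a) →
      ∃ R ∈ Ico a b, FinitePerimeter 3 (Ω ∩ {x | japaneseBracket x ≤ R}) ∧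
        FinitePerimeter 3 (Ω \ {x | japaneseBracket x ≤ R}) ∧
        perimeter 3 (Ω ∩ {x | japaneseBracket x ≤ R}) +
          perimeter 3 (Ω \ {x | japaneseBracket x ≤ R}) ≤ perimeter 3 Ω + C * c := by
  obtain ⟨C, hC0, hC⟩ := exists_abs_deriv_smoothTransition_le
  refine ⟨2 * C, by positivity, fun Ω hm hP a b c hab h => ?_⟩
  obtain ⟨R, hR, hfr⟩ := exists_frequently_slope_le (continuous_volume_inter_sublevel hm) hab h
  have key : ∀ F₁ F₂, Admissible F₁ → Admissible F₂ →
      (∫ x in Ω ∩ {x | japaneseBracket x ≤ R}, dvg F₁ x) +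
        ∫ x in Ω \ {x | japaneseBracket x ≤ R}, dvg F₂ x ≤ perimeter 3 Ω + 2 * C * c := by
    intro F₁ F₂ h₁ h₂
    refine le_of_tendsto_of_frequently (tendsto_setIntegral_glue Ω
      (integrable_dvg h₁.contDiff h₁.compact) (integrable_dvg h₂.contDiff h₂.compact) R) ?_
    refine (hfr.and_eventually self_mem_nhdsWithin).mono fun z hz => ?_
    refine (setIntegral_glue_le hC hm hP h₁ h₂ hz.2).trans ?_
    gcongr
    exact hz.1
  have h1 : FinitePerimeter 3 (Ω ∩ {x | japaneseBracket x ≤ R}) :=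
    finitePerimeter_of_forall_le fun F hF => by
      simpa [dvg_zero] using key F _ hF zero_admissible
  have h2 : FinitePerimeter 3 (Ω \ {x | japaneseBracket x ≤ R}) :=
    finitePerimeter_of_forall_le fun F hF => by
      simpa [dvg_zero] using key _ F zero_admissible hF
  refine ⟨R, hR, h1, h2, ?_⟩
  have h3 : ∀ F₂, Admissible F₂ → perimeter 3 (Ω ∩ {x | japaneseBracket x ≤ R}) ≤
      perimeter 3 Ω + 2 * C * c - ∫ x in Ω \ {x | japaneseBracket x ≤ R}, dvg F₂ x :=
    fun F₂ hF₂ => perimeter_le_of_forall_le fun F₁ hF₁ => by linarith [key F₁ F₂ hF₁ hF₂]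
  have h4 : perimeter 3 (Ω \ {x | japaneseBracket x ≤ R}) ≤
      perimeter 3 Ω + 2 * C * c - perimeter 3 (Ω ∩ {x | japaneseBracket x ≤ R}) :=
    perimeter_le_of_forall_le fun F hF => by linarith [h3 F hF]
  linarith

lemma exists_finitePerimeter_volume_le {A : ℝ} (hA : 0 < A) : ∃ S : Set E3, MeasurableSet S ∧
    FinitePerimeter 3 S ∧ 0 < volume S ∧ volume S ≤ ENNReal.ofReal A := by
  obtain ⟨C, -, hC⟩ := exists_cut
  have hu : FinitePerimeter 3 univ := finitePerimeter_of_forall_le (c := 0) fun F hF => by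
    rw [setIntegral_univ, integral_dvg_eq_zero hF.contDiff hF.compact]
  set m : ℝ → ℝ := fun s => volume.real (univ ∩ {x | japaneseBracket x ≤ s}) with hm
  have hmc : Continuous m := continuous_volume_inter_sublevel MeasurableSet.univ
  have hm1 : m 1 = 0 := by
    have h0 : volume (univ ∩ {x | japaneseBracket x ≤ 1}) = 0 := by
      refine measure_mono_null (fun x hx => ?_) (ae_japaneseBracket_ne 1)
      have h1 : japaneseBracket x ≤ 1 := hx.2
      have h2 : 1 ≤ japaneseBracket x := by
        rw [japaneseBracket, Real.one_le_sqrt]; nlinarith [sq_nonneg ‖x‖]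
      simpa using le_antisymm h1 h2
    simp only [hm, measureReal_def, h0, ENNReal.toReal_zero]
  have hev : ∀ᶠ b in 𝓝[>] (1:ℝ), m b < A :=
    (hmc.continuousAt.eventually_lt_const (by rwa [hm1])).filter_mono nhdsWithin_le_nhds
  obtain ⟨b, hbA, hb1⟩ := (hev.and self_mem_nhdsWithin).exists
  have hb : 1 < b := hb1
  obtain ⟨R, hR, h1, -⟩ := hC univ MeasurableSet.univ hu ((1 + b) / 2) b
    ((m b - m ((1 + b) / 2)) / (b - (1 + b) / 2) + 1) (by linarith) (by
      have : 0 < b - (1 + b) / 2 := by linarith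
      rw [add_mul, div_mul_cancel₀ _ this.ne']
      linarith)
  refine ⟨_, MeasurableSet.univ.inter (measurableSet_japaneseBracket_le R), h1, ?_, ?_⟩
  · have ho : IsOpen {x | japaneseBracket x < R} :=
      isOpen_lt continuous_japaneseBracket continuous_const
    have h0 : (0 : E3) ∈ {x | japaneseBracket x < R} := by
      have : (1:ℝ) < R := by linarith [hR.1]
      simpa [japaneseBracket] using this
    refine (ho.measure_pos volume ⟨0, h0⟩).trans_le (measure_mono fun x hx => ⟨trivial, ?_⟩)
    exact le_of_lt (show japaneseBracket x < R from hx)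
  · have hsub : univ ∩ {x | japaneseBracket x ≤ R} ⊆ univ ∩ {x | japaneseBracket x ≤ b} :=
      inter_subset_inter_right _ fun x hx => le_trans hx hR.2.le
    refine (measure_mono hsub).trans ?_
    have hf : volume (univ ∩ {x | japaneseBracket x ≤ b}) ≠ ⊤ := by
      rw [univ_inter]; exact volume_japaneseBracket_le_ne_top b
    rw [← ofReal_measureReal hf]
    exact ENNReal.ofReal_le_ofReal hbA.le

lemma ldEnergy_nonneg {S : Set E3} (hS : FinitePerimeter 3 S) : 0 ≤ ldEnergy S :=
  add_nonneg (perimeter_nonneg hS) (coulomb_nonneg S)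

lemma eLe_nonneg (A : ℝ) : 0 ≤ eLe A := by
  refine Real.sInf_nonneg ?_
  rintro _ ⟨S, -, hP, -, -, rfl⟩
  exact div_nonneg (ldEnergy_nonneg hP) ENNReal.toReal_nonneg

lemma eLe_le_ldRatio {A : ℝ} {S : Set E3} (hm : MeasurableSet S) (hP : FinitePerimeter 3 S)
    (h0 : 0 < volume S) (hA : volume S ≤ ENNReal.ofReal A) : eLe A ≤ ldRatio S := by
  refine csInf_le ⟨0, ?_⟩ ⟨S, hm, hP, h0, hA, rfl⟩
  rintro _ ⟨S, -, hP, -, -, rfl⟩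
  exact div_nonneg (ldEnergy_nonneg hP) ENNReal.toReal_nonneg

lemma eLe_mul_le_ldEnergy {A : ℝ} {S : Set E3} (hm : MeasurableSet S)
    (hP : FinitePerimeter 3 S) (hA : volume S ≤ ENNReal.ofReal A) :
    eLe A * volume.real S ≤ ldEnergy S := by
  rcases (zero_le (a := volume S)).eq_or_lt with h0 | h0
  · simpa [measureReal_def, ← h0] using ldEnergy_nonneg hP
  · have hpos : 0 < volume.real S :=
      ENNReal.toReal_pos h0.ne' (ne_top_of_le_ne_top ENNReal.ofReal_ne_top hA)
    exact (le_div_iff₀ hpos).1 (eLe_le_ldRatio hm hP h0 hA)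

/-- Almost minimizers which, after a translation, do not vanish near the origin. -/
lemma exists_almost_minimizer {A : ℝ} (hA : 0 < A) : ∃ r > 0, ∀ n : ℕ, ∃ S : Set E3,
    MeasurableSet S ∧ FinitePerimeter 3 S ∧ volume S ≤ ENNReal.ofReal A ∧
    volume (ball (0 : E3) r) / 2 ≤ volume (S ∩ ball 0 r) ∧
    ldEnergy S ≤ (eLe A + 1 / (n + 1)) * volume.real S := by
  have he := eLe_nonneg A
  refine ⟨1 / (4 * (eLe A + 1)), by positivity, fun n => ?_⟩
  set r := 1 / (4 * (eLe A + 1)) with hr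
  have hn : (0:ℝ) < 1 / (n + 1) := by positivity
  have hn1 : (1:ℝ) / (n + 1) ≤ 1 := by
    rw [div_le_one (by positivity)]; linarith [n.cast_nonneg (α := ℝ)]
  obtain ⟨S₀, hS₀⟩ := exists_finitePerimeter_volume_le hA
  obtain ⟨_, ⟨Ω, hm, hP, h0, hv, rfl⟩, hlt⟩ := exists_lt_of_csInf_lt
    (s := {r | ∃ Ω : Set E3, MeasurableSet Ω ∧ FinitePerimeter 3 Ω ∧
      0 < volume Ω ∧ volume Ω ≤ ENNReal.ofReal A ∧ r = ldRatio Ω})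
    ⟨_, S₀, hS₀.1, hS₀.2.1, hS₀.2.2.1, hS₀.2.2.2, rfl⟩
    (show eLe A < eLe A + 1 / (n + 1) by linarith)
  have hvt : volume Ω ≠ ⊤ := ne_top_of_le_ne_top ENNReal.ofReal_ne_top hv
  have hpos : 0 < volume.real Ω := ENNReal.toReal_pos h0.ne' hvt
  have hE : ldEnergy Ω ≤ (eLe A + 1 / (n + 1)) * volume.real Ω :=
    ((div_lt_iff₀ hpos).1 hlt).le
  have hper : perimeter 3 Ω ≤ (eLe A + 1) * volume.real Ω := by
    have h1 : perimeter 3 Ω ≤ ldEnergy Ω := le_add_of_nonneg_right (coulomb_nonneg Ω)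
    refine (h1.trans hE).trans ?_
    gcongr
  obtain ⟨x, hx⟩ := exists_half_volume_ball_le hm hP hvt (r := r) (by positivity) (by
    have h2 : 2 * (perimeter 3 Ω * r) ≤ 2 * ((eLe A + 1) * volume.real Ω * r) := by
      gcongr
    have h3 : 2 * ((eLe A + 1) * volume.real Ω * r) = volume.real Ω / 2 := by
      rw [hr]; field_simp; ring
    linarith)
  have hvol : ∀ s : Set E3, volume ((· + x) ⁻¹' s) = volume s :=
    fun s => measure_preimage_add_right volume x s
  refine ⟨(· + x) ⁻¹' Ω, hm.preimage (measurable_add_const x), finitePerimeter_translate hP x,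
    (hvol Ω).trans_le hv, ?_, ?_⟩
  · have : (· + x) ⁻¹' Ω ∩ ball 0 r = (· + x) ⁻¹' (ball x r ∩ Ω) := by
      rw [preimage_inter, preimage_add_right_ball, sub_self, inter_comm]
    rw [this, hvol]
    exact hx
  · have h1 : ldEnergy ((· + x) ⁻¹' Ω) ≤ ldEnergy Ω :=
      add_le_add (perimeter_translate_le hP x) (coulomb_translate Ω x).le
    rw [measureReal_def, hvol]
    exact h1.trans hE

lemma tendsto_setIntegral_of_ae_eventually {T : ℕ → Set E3} {S : Set E3}
    (hT : ∀ n, MeasurableSet (T n)) (hS : MeasurableSet S)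
    (h : ∀ᵐ x, ∀ᶠ n in atTop, (x ∈ T n ↔ x ∈ S)) {f : E3 → ℝ} (hf : Integrable f) :
    Tendsto (fun n => ∫ x in T n, f x) atTop (𝓝 (∫ x in S, f x)) := by
  simp_rw [← integral_indicator (hT _), ← integral_indicator hS]
  refine tendsto_integral_of_dominated_convergence (fun x => ‖f x‖)
    (fun n => (hf.indicator (hT n)).aestronglyMeasurable) hf.norm
    (fun n => Eventually.of_forall fun x => norm_indicator_le_norm_self _ _) ?_
  filter_upwards [h] with x hx
  refine tendsto_const_nhds.congr' ?_
  filter_upwards [hx] with n hn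
  by_cases hxS : x ∈ S
  · rw [indicator_of_mem hxS, indicator_of_mem (hn.2 hxS)]
  · rw [indicator_of_notMem hxS, indicator_of_notMem (fun h' => hxS (hn.1 h'))]

lemma tendsto_volume_inter_of_ae_eventually {T : ℕ → Set E3} {S B : Set E3}
    (hT : ∀ n, MeasurableSet (T n)) (hS : MeasurableSet S)
    (h : ∀ᵐ x, ∀ᶠ n in atTop, (x ∈ T n ↔ x ∈ S)) (hB : MeasurableSet B) (hBv : volume B ≠ ⊤) :
    Tendsto (fun n => volume.real (T n ∩ B)) atTop (𝓝 (volume.real (S ∩ B))) := by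
  have := tendsto_setIntegral_of_ae_eventually hT hS h
    ((integrable_indicator_iff hB).2 (integrableOn_const hBv (C := (1:ℝ))))
  simpa [setIntegral_indicator hB] using this

lemma volume_le_of_ae_eventually {T : ℕ → Set E3} {S : Set E3} {a : ENNReal}
    (hT : ∀ n, MeasurableSet (T n)) (hS : MeasurableSet S)
    (h : ∀ᵐ x, ∀ᶠ n in atTop, (x ∈ T n ↔ x ∈ S)) (hv : ∀ n, volume (T n) ≤ a) :
    volume S ≤ a := by
  calc volume S = ∫⁻ x, S.indicator 1 x := (lintegral_indicator_one hS).symm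
    _ ≤ ∫⁻ x, liminf (fun n => (T n).indicator (1 : E3 → ENNReal) x) atTop := by
        refine lintegral_mono_ae ?_
        filter_upwards [h] with x hx
        refine le_liminf_of_le (by isBoundedDefault) ?_
        filter_upwards [hx] with n hn
        by_cases hxS : x ∈ S
        · rw [indicator_of_mem (hn.2 hxS), indicator_of_mem hxS]
        · rw [indicator_of_notMem hxS]; exact zero_le
    _ ≤ liminf (fun n => ∫⁻ x, (T n).indicator 1 x) atTop :=
        lintegral_liminf_le fun n => measurable_one.indicator (hT n)
    _ ≤ liminf (fun _ : ℕ => a) atTop := by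
        refine liminf_le_liminf (Eventually.of_forall fun n => ?_)
        simp only [lintegral_indicator_one (hT n)]
        exact hv n
    _ = a := liminf_const a

/-- Along a converging sequence of almost minimizers, cutting off the mass escaping to infinity
gives sets whose energy is controlled by the mass of the limit. -/
lemma exists_truncated_energy_le {A : ℝ} (hA : 0 < A) {Ω : ℕ → Set E3} {S : Set E3}
    (hm : ∀ n, MeasurableSet (Ω n)) (hP : ∀ n, FinitePerimeter 3 (Ω n))
    (hv : ∀ n, volume (Ω n) ≤ ENNReal.ofReal A)
    (hE : ∀ n : ℕ, ldEnergy (Ω n) ≤ (eLe A + 1 / (n + 1)) * volume.real (Ω n))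
    (hS : MeasurableSet S) (hSv : volume S ≠ ⊤)
    (h : ∀ᵐ x, ∀ᶠ n in atTop, (x ∈ Ω n ↔ x ∈ S)) :
    ∃ K : ℝ, ∀ N : ℕ, ∃ n ≥ N, ∃ R ≥ (N : ℝ),
      FinitePerimeter 3 (Ω n ∩ {x | japaneseBracket x ≤ R}) ∧
      ldEnergy (Ω n ∩ {x | japaneseBracket x ≤ R}) ≤
        eLe A * volume.real S + K * (1 / ((N : ℝ) + 1)) := by
  obtain ⟨C, hC0, hC⟩ := exists_cut
  have he := eLe_nonneg A
  refine ⟨eLe A + A + C * (A + 1), fun N => ?_⟩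
  have hL : (0:ℝ) < N + 1 := by positivity
  have hlim := tendsto_volume_inter_of_ae_eventually hm hS h
    (measurableSet_japaneseBracket_le (2 * (N + 1))) (volume_japaneseBracket_le_ne_top _)
  have hlt : volume.real (S ∩ {x | japaneseBracket x ≤ 2 * ((N:ℝ) + 1)}) <
      volume.real S + 1 / ((N:ℝ) + 1) :=
    lt_add_of_le_of_pos (measureReal_mono inter_subset_left hSv) (by positivity)
  obtain ⟨n, hnv, hnN⟩ := ((hlim.eventually_lt_const hlt).and (eventually_ge_atTop N)).exists
  have hvt : volume (Ω n) ≠ ⊤ := ne_top_of_le_ne_top ENNReal.ofReal_ne_top (hv n)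
  have hvA : volume.real (Ω n) ≤ A := ENNReal.toReal_le_of_le_ofReal hA.le (hv n)
  obtain ⟨R, hR, h1, h2, h3⟩ := hC (Ω n) (hm n) (hP n) (N + 1) (2 * (N + 1))
    ((A + 1) * (1 / (N + 1))) (by linarith) (by
      have e1 : (A + 1) * (1 / ((N:ℝ) + 1)) * (2 * (N + 1) - (N + 1)) = A + 1 := by
        field_simp; ring
      rw [e1]
      have e2 : volume.real (Ω n ∩ {x | japaneseBracket x ≤ 2 * ((N:ℝ) + 1)}) ≤ A :=
        (measureReal_mono inter_subset_left hvt).trans hvA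
      have e3 : 0 ≤ volume.real (Ω n ∩ {x | japaneseBracket x ≤ (N:ℝ) + 1}) :=
        measureReal_nonneg
      linarith)
  refine ⟨n, hnN, R, by linarith [hR.1], h1, ?_⟩
  set T := {x | japaneseBracket x ≤ R} with hT
  have hTm : MeasurableSet T := measurableSet_japaneseBracket_le R
  have hcoul := coulomb_inter_add_diff_le hvt hTm
  have hout := eLe_mul_le_ldEnergy ((hm n).diff hTm) h2 ((measure_mono sdiff_subset).trans (hv n))
  have hsum : volume.real (Ω n ∩ T) + volume.real (Ω n \ T) = volume.real (Ω n) :=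
    measureReal_inter_add_sdiff hTm hvt
  have hin : volume.real (Ω n ∩ T) ≤ volume.real S + 1 / ((N:ℝ) + 1) := by
    have hsub : Ω n ∩ T ⊆ Ω n ∩ {x | japaneseBracket x ≤ 2 * ((N:ℝ) + 1)} :=
      inter_subset_inter_right _ fun x hx => le_trans hx hR.2.le
    exact (measureReal_mono hsub
      (ne_top_of_le_ne_top hvt (measure_mono inter_subset_left))).trans hnv.le
  have herr : 1 / ((n:ℝ) + 1) * volume.real (Ω n) ≤ 1 / ((N:ℝ) + 1) * A := by
    have : (N:ℝ) ≤ n := by exact_mod_cast hnN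
    gcongr
  have hmul := mul_le_mul_of_nonneg_left hin he
  have hEn := hE n
  unfold ldEnergy at *
  rw [← hsum] at hEn
  rw [← hsum] at herr
  nlinarith

lemma ldEnergy_le_of_almost_minimizers {A : ℝ} (hA : 0 < A) {Ω : ℕ → Set E3} {S : Set E3}
    (hm : ∀ n, MeasurableSet (Ω n)) (hP : ∀ n, FinitePerimeter 3 (Ω n))
    (hv : ∀ n, volume (Ω n) ≤ ENNReal.ofReal A)
    (hE : ∀ n : ℕ, ldEnergy (Ω n) ≤ (eLe A + 1 / (n + 1)) * volume.real (Ω n))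
    (hS : MeasurableSet S) (hSv : volume S ≠ ⊤)
    (h : ∀ᵐ x, ∀ᶠ n in atTop, (x ∈ Ω n ↔ x ∈ S)) :
    FinitePerimeter 3 S ∧ ldEnergy S ≤ eLe A * volume.real S := by
  obtain ⟨K, hK⟩ := exists_truncated_energy_le hA hm hP hv hE hS hSv h
  choose n hn R hR hTP hTE using hK
  set T : ℕ → Set E3 := fun N => Ω (n N) ∩ {x | japaneseBracket x ≤ R N} with hT
  have hTm : ∀ N, MeasurableSet (T N) := fun N =>
    (hm _).inter (measurableSet_japaneseBracket_le _)
  have hTv : ∀ N, volume (T N) ≠ ⊤ := fun N =>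
    ne_top_of_le_ne_top ENNReal.ofReal_ne_top ((measure_mono inter_subset_left).trans (hv (n N)))
  have hTS : ∀ᵐ x, ∀ᶠ N in atTop, (x ∈ T N ↔ x ∈ S) := by
    filter_upwards [h] with x hx
    have hn' : Tendsto n atTop atTop := tendsto_atTop_mono hn tendsto_id
    filter_upwards [hn'.eventually hx, eventually_ge_atTop ⌈japaneseBracket x⌉₊] with N hN hN'
    have hle : japaneseBracket x ≤ R N := ((Nat.ceil_le.1 hN').trans (hR N))
    exact ⟨fun h' => hN.1 h'.1, fun h' => ⟨hN.2 h', hle⟩⟩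
  have key : ∀ F, Admissible F →
      coulomb S ≤ eLe A * volume.real S + K * 0 - ∫ x in S, dvg F x := fun F hF => by
    refine coulomb_le_of_tendsto hTm hS hTv hSv hTS
      ((tendsto_const_nhds.add (tendsto_one_div_add_atTop_nhds_zero_nat.const_mul K)).sub
        (tendsto_setIntegral_of_ae_eventually hTm hS hTS (integrable_dvg hF.contDiff hF.compact)))
      fun N => ?_
    have h1 := setIntegral_dvg_le (hTP N) hF
    have h2 := hTE N
    unfold ldEnergy at h2
    linarith
  have key' : ∀ F, Admissible F →
      ∫ x in S, dvg F x ≤ eLe A * volume.real S - coulomb S := fun F hF => by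
    linarith [key F hF]
  refine ⟨finitePerimeter_of_forall_le key', ?_⟩
  unfold ldEnergy
  linarith [perimeter_le_of_forall_le key']

/-- the relaxed problem `e_≤(A)` always has a minimizer. -/
theorem eLe_attained (A : ℝ) (hA : 0 < A) :
    ∃ Ω : Set E3, MeasurableSet Ω ∧ FinitePerimeter 3 Ω ∧
      0 < volume Ω ∧ volume Ω ≤ ENNReal.ofReal A ∧ ldRatio Ω = eLe A := by
  have he := eLe_nonneg A
  obtain ⟨r, hr, hΩ⟩ := exists_almost_minimizer hA
  choose Ω hm hP hv hhalf hE using hΩ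
  have hvA : ∀ n, volume.real (Ω n) ≤ A := fun n => ENNReal.toReal_le_of_le_ofReal hA.le (hv n)
  have hper : ∀ n, perimeter 3 (Ω n) ≤ (eLe A + 1) * A := fun n => by
    have h1 : perimeter 3 (Ω n) ≤ ldEnergy (Ω n) := le_add_of_nonneg_right (coulomb_nonneg _)
    have hn1 : (1:ℝ) / (n + 1) ≤ 1 := by
      rw [div_le_one (by positivity)]; linarith [n.cast_nonneg (α := ℝ)]
    refine (h1.trans (hE n)).trans ?_
    gcongr
    exact hvA n
  obtain ⟨φ, hφ, S, hS, hconv⟩ := exists_subseq_ae_eventually_mem_iff hm hv hP hper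
  have hSA : volume S ≤ ENNReal.ofReal A :=
    volume_le_of_ae_eventually (fun n => hm (φ n)) hS hconv fun n => hv _
  have hSt : volume S ≠ ⊤ := ne_top_of_le_ne_top ENNReal.ofReal_ne_top hSA
  have hball : (volume (ball (0:E3) r) / 2).toReal ≤ volume.real (S ∩ ball 0 r) := by
    refine ge_of_tendsto' (tendsto_volume_inter_of_ae_eventually (fun n => hm (φ n)) hS hconv
      measurableSet_ball measure_ball_lt_top.ne) fun n => ?_
    exact ENNReal.toReal_mono (ne_top_of_le_ne_top measure_ball_lt_top.ne
      (measure_mono inter_subset_right)) (hhalf (φ n))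
  have hpos : 0 < volume.real S := by
    have h1 : 0 < (volume (ball (0:E3) r) / 2).toReal :=
      ENNReal.toReal_pos (ENNReal.div_pos (measure_ball_pos volume 0 hr).ne' (by simp)).ne'
        (ENNReal.div_lt_top measure_ball_lt_top.ne (by simp)).ne
    exact (h1.trans_le hball).trans_le (measureReal_mono inter_subset_left hSt)
  have hS0 : 0 < volume S := (ENNReal.toReal_pos_iff.1 hpos).1
  obtain ⟨hSP, hSE⟩ := ldEnergy_le_of_almost_minimizers hA (fun n => hm (φ n))
    (fun n => hP (φ n)) (fun n => hv (φ n)) (fun n => (hE (φ n)).trans (by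
      have : (n:ℝ) ≤ φ n := by exact_mod_cast hφ.le_apply
      gcongr)) hS hSt hconv
  exact ⟨S, hS, hSP, hS0, hSA, le_antisymm ((div_le_iff₀ hpos).2 hSE)
    (eLe_le_ldRatio hS hSP hS0 hSA)⟩
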